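/- Let (φ_{t,s})_{s≤t∈I} be an evolution family over parallel slit half-planes (D_t)_{t∈I}, and let λ(t) denote the angular residue of φ_{t,0}. Then for every pair s ≤ t in I, the map φ_{t,s} satisfies (H.2) with angular residue exactly λ(t) − λ(s); moreover λ(t) − λ(s) is a nonnegative real number, i.e. λ is real-valued and non-decreasing on I. -/

import Mathlib

open Complex Set Filter Topology Bornology MeasureTheory Metric

noncomputable section

/-- The upper half-plane `ℍ = {z : ℂ | 0 < Im z}`. -/
def UHP : Set ℂ := {z : ℂ | 0 < z.im}

/-- The half-plane `ℍ_η = {z : ℂ | η < Im z}`. -/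
def HP (η : ℝ) : Set ℂ := {z : ℂ | η < z.im}

/-- The sector `△_θ = {z : ℂ | θ < arg z < π - θ}`. -/
def Sector (θ : ℝ) : Set ℂ :=
  {z : ℂ | θ < Complex.arg z ∧ Complex.arg z < Real.pi - θ}

/-- A closed horizontal line segment of positive length contained in `ℍ`. -/
def IsHorizontalSlit (C : Set ℂ) : Prop :=
  ∃ y xl xr : ℝ, 0 < y ∧ xl < xr ∧
    C = {z : ℂ | z.im = y ∧ z.re ∈ Set.Icc xl xr}

/-- A parallel slit half-plane with `N` slits: `ℍ` minus `N` pairwise disjoint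
closed horizontal segments of positive length. -/
def IsParallelSlitHalfPlaneN (N : ℕ) (D : Set ℂ) : Prop :=
  ∃ C : Fin N → Set ℂ,
    (∀ j, IsHorizontalSlit (C j)) ∧
    (Pairwise fun i j => Disjoint (C i) (C j)) ∧
    D = UHP \ ⋃ j, C j

/-- A parallel slit half-plane (with some number of slits). -/
def IsParallelSlitHalfPlane (D : Set ℂ) : Prop :=
  ∃ N : ℕ, IsParallelSlitHalfPlaneN N D

/-- (H.1): hydrodynamic normalization at infinity. -/
def SatisfiesH1 (D : Set ℂ) (f : ℂ → ℂ) : Prop :=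
  ∃ η : ℝ, 0 ≤ η ∧ HP η ⊆ D ∧
    Tendsto (fun z => f z - z) (cobounded ℂ ⊓ 𝓟 (HP η)) (𝓝 0)

/-- (H.2): `f` has angular residue `c` at infinity, i.e. `z (f z - z) → -c`
as `z → ∞` within every sector `△_θ`. -/
def SatisfiesH2 (f : ℂ → ℂ) (c : ℂ) : Prop :=
  ∀ θ : ℝ, 0 < θ → θ < Real.pi / 2 →
    Tendsto (fun z => z * (f z - z)) (cobounded ℂ ⊓ 𝓟 (Sector θ)) (𝓝 (-c))

/-- `F` is an ℍ-hull: relatively closed in `ℍ` with `ℍ \ F` a simply connected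
domain. -/
def IsHHull (F : Set ℂ) : Prop :=
  F ⊆ UHP ∧ closure F ∩ UHP ⊆ F ∧
    IsConnected (UHP \ F) ∧ SimplyConnectedSpace ↥(UHP \ F)

/-- `η_D = min {Im w | w ∈ ℍ \ D}`. -/
def etaD (D : Set ℂ) : ℝ := sInf (Complex.im '' (UHP \ D))

/-- A (chordal) evolution family `φ t s : D s → D t` (for `s ≤ t` in `I`) over
parallel slit half-planes `D t`, where `lam t` is the angular residue of
`φ t 0` at infinity. -/
structure IsEvolutionFamily (I : Set ℝ) (D : ℝ → Set ℂ)
    (φ : ℝ → ℝ → ℂ → ℂ) (lam : ℝ → ℂ) : Prop where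
  slit : ∀ t ∈ I, IsParallelSlitHalfPlane (D t)
  mapsTo : ∀ s ∈ I, ∀ t ∈ I, s ≤ t → Set.MapsTo (φ t s) (D s) (D t)
  holo : ∀ s ∈ I, ∀ t ∈ I, s ≤ t → DifferentiableOn ℂ (φ t s) (D s)
  inj : ∀ s ∈ I, ∀ t ∈ I, s ≤ t → Set.InjOn (φ t s) (D s)
  h1 : ∀ s ∈ I, ∀ t ∈ I, s ≤ t → SatisfiesH1 (D s) (φ t s)
  h2 : ∀ s ∈ I, ∀ t ∈ I, s ≤ t → ∃ c : ℂ, SatisfiesH2 (φ t s) c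
  h3 : ∀ s ∈ I, ∀ t ∈ I, s ≤ t → IsHHull (D t \ φ t s '' D s)
  ef1 : ∀ t ∈ I, Set.EqOn (φ t t) id (D t)
  ef2 : ∀ s ∈ I, ∀ t ∈ I, ∀ u ∈ I, s ≤ t → t ≤ u →
    ∀ z ∈ D s, φ u s z = φ u t (φ t s z)
  lam_res : ∀ t ∈ I, SatisfiesH2 (φ t 0) (lam t)
  ef3 : ContinuousOn lam I

/-- A (chordal) Loewner chain `f t : D t → Dcod` over parallel slit
half-planes `D t` with codomain `Dcod`, where `ell t` is the angular residue
of `f t` at infinity. -/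
structure IsLoewnerChain (I : Set ℝ) (D : ℝ → Set ℂ) (Dcod : Set ℂ)
    (f : ℝ → ℂ → ℂ) (ell : ℝ → ℂ) : Prop where
  slit : ∀ t ∈ I, IsParallelSlitHalfPlane (D t)
  slitcod : IsParallelSlitHalfPlane Dcod
  mapsTo : ∀ t ∈ I, Set.MapsTo (f t) (D t) Dcod
  holo : ∀ t ∈ I, DifferentiableOn ℂ (f t) (D t)
  inj : ∀ t ∈ I, Set.InjOn (f t) (D t)
  h1 : ∀ t ∈ I, SatisfiesH1 (D t) (f t)
  h2 : ∀ t ∈ I, SatisfiesH2 (f t) (ell t)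
  h3 : ∀ t ∈ I, IsHHull (Dcod \ f t '' D t)
  lc1 : ∀ s ∈ I, ∀ t ∈ I, s ≤ t → f s '' D s ⊆ f t '' D t
  lc2 : ContinuousOn ell I

/-- `(Lip)_μ`: Lipschitz continuity of `t ↦ f t` w.r.t. the measure `μ`,
uniformly on compact subsets of `D`. -/
def SatisfiesLip (I : Set ℝ) (μ : Measure ℝ) (D : Set ℂ)
    (f : ℝ → ℂ → ℂ) : Prop :=
  ∀ K : Set ℂ, K ⊆ D → IsCompact K → ∃ L : ℝ,
    ∀ s ∈ I, ∀ t ∈ I, s ≤ t → ∀ z ∈ K,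
      ‖f t z - f s z‖ ≤ L * (μ (Set.Ioc s t)).toReal

/-- `(AC)_μ`: absolute continuity of `t ↦ f t` w.r.t. the measure `μ`,
uniformly on compact subsets of `D`. -/
def SatisfiesAC (I : Set ℝ) (μ : Measure ℝ) (D : Set ℂ)
    (f : ℝ → ℂ → ℂ) : Prop :=
  ∀ K : Set ℂ, K ⊆ D → IsCompact K →
    ∃ ν : Measure ℝ, ν ≪ μ ∧
      (∀ a ∈ I, ∀ b ∈ I, ν (Set.Icc a b) < ⊤) ∧
      ∀ s ∈ I, ∀ t ∈ I, s ≤ t → ∀ z ∈ K,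
        ‖f t z - f s z‖ ≤ (ν (Set.Ioc s t)).toReal

/-- The symmetric difference quotient
`(f (t+δ) z - f (t-δ) z) / μ((t-δ, t+δ))`. -/
def symmQuot (μ : Measure ℝ) (f : ℝ → ℂ → ℂ) (t δ : ℝ) (z : ℂ) : ℂ :=
  (f (t + δ) z - f (t - δ) z) / ((μ (Set.Ioo (t - δ) (t + δ))).toReal : ℂ)

/-- A cross-cut of a domain `G`. -/
def IsCrossCut (G C : Set ℂ) : Prop :=
  ∃ c : ℝ → ℂ, ContinuousOn c (Set.Icc 0 1) ∧ Set.InjOn c (Set.Icc 0 1) ∧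
    c 0 ∈ frontier G ∧ c 1 ∈ frontier G ∧ c '' Set.Ioo 0 1 ⊆ G ∧
    C = c '' Set.Icc 0 1

/-- `C` separates `S` from `∞` in `G`: `S` is disjoint from the unbounded
connected component of `G \ C`. -/
def SeparatesFromInfty (G C S : Set ℂ) : Prop :=
  ∀ z ∈ S ∩ (G \ C), Bornology.IsBounded (connectedComponentIn (G \ C) z)

/-- The local growth property of a family of hulls `(F t)_{t ∈ [0,T]}` in `D`. -/
def LocalGrowth (T : ℝ) (D : Set ℂ) (F : ℝ → Set ℂ) : Prop :=
  ∀ ε : ℝ, 0 < ε → ∃ δ ∈ Set.Ioo 0 T, ∀ t ∈ Set.Icc 0 (T - δ),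
    ∃ C : Set ℂ, IsCrossCut (D \ F t) C ∧ Metric.diam C < ε ∧
      SeparatesFromInfty (D \ F t) C (F (t + δ) \ F t)

/-- Carathéodory kernel of a sequence of domains w.r.t. the point `a`. -/
def kernelAt (a : ℂ) (G : ℕ → Set ℂ) : Set ℂ :=
  connectedComponentIn
    {z : ℂ | ∃ r > 0, ∃ N : ℕ, ∀ n ≥ N, Metric.ball z r ⊆ G n} a

/-- Left continuity in Carathéodory's sense of `(F t)` at `t₀`. -/
def CaratheodoryLeftContinuousAt (D : Set ℂ) (F : ℝ → Set ℂ)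
    (T t₀ : ℝ) : Prop :=
  ∀ a ∈ D \ F T, ∀ s : ℕ → ℝ,
    Monotone s → (∀ n, s n ∈ Set.Ico 0 t₀) → Tendsto s atTop (𝓝 t₀) →
      kernelAt a (fun n => D \ F (s n)) = D \ F t₀

/-- The open annulus `{ζ | 1 < ‖ζ‖ < R₀}`. -/
def unitAnnulus (R₀ : ℝ) : Set ℂ := {ζ | 1 < ‖ζ‖ ∧ ‖ζ‖ < R₀}

/-- `2πi` times the winding number around `w` of the image under `p` of the circle of
radius `R` centred at the origin. -/
def windingIntegral (p : ℂ → ℂ) (R : ℝ) (w : ℂ) : ℂ :=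
  ∮ ζ in C(0, R), deriv p ζ / (p ζ - w)

theorem isOpen_unitAnnulus (R₀ : ℝ) : IsOpen (unitAnnulus R₀) :=
  (isOpen_lt continuous_const continuous_norm).inter (isOpen_lt continuous_norm continuous_const)

theorem sphere_subset_unitAnnulus {R R₀ : ℝ} (h1 : 1 < R) (h2 : R < R₀) :
    sphere (0 : ℂ) R ⊆ unitAnnulus R₀ := by
  intro ζ hζ
  have : ‖ζ‖ = R := by simpa using hζ
  exact ⟨this ▸ h1, this ▸ h2⟩

section Winding

variable {p : ℂ → ℂ} {R R₀ : ℝ}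

theorem hasDerivAt_of_mem_unitAnnulus (hp : DifferentiableOn ℂ p (unitAnnulus R₀)) {ζ : ℂ}
    (hζ : ζ ∈ unitAnnulus R₀) : HasDerivAt p (deriv p ζ) ζ :=
  (hp.differentiableAt ((isOpen_unitAnnulus R₀).mem_nhds hζ)).hasDerivAt

theorem continuousOn_sphere_of_differentiableOn (hp : DifferentiableOn ℂ p (unitAnnulus R₀))
    (h1 : 1 < R) (h2 : R < R₀) : ContinuousOn p (sphere 0 R) :=
  hp.continuousOn.mono (sphere_subset_unitAnnulus h1 h2)

theorem circleIntegrable_deriv_div (hp : DifferentiableOn ℂ p (unitAnnulus R₀))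
    (h1 : 1 < R) (h2 : R < R₀) {w : ℂ} (hw : ∀ ζ ∈ sphere (0 : ℂ) R, p ζ ≠ w) :
    CircleIntegrable (fun ζ => deriv p ζ / (p ζ - w)) 0 R := by
  apply ContinuousOn.circleIntegrable (by linarith)
  have hd : ContinuousOn (deriv p) (sphere 0 R) :=
    (hp.deriv (isOpen_unitAnnulus R₀)).continuousOn.mono (sphere_subset_unitAnnulus h1 h2)
  exact hd.div ((continuousOn_sphere_of_differentiableOn hp h1 h2).sub continuousOn_const)
    fun ζ hζ => sub_ne_zero.2 (hw ζ hζ)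

theorem windingIntegral_eq_of_norm_sub_lt (hp : DifferentiableOn ℂ p (unitAnnulus R₀))
    (h1 : 1 < R) (h2 : R < R₀) {w w' : ℂ}
    (hw : ∀ ζ ∈ sphere (0 : ℂ) R, ‖w' - w‖ < ‖p ζ - w'‖) :
    windingIntegral p R w = windingIntegral p R w' := by
  have hne' : ∀ ζ ∈ sphere (0 : ℂ) R, p ζ ≠ w' := by
    intro ζ hζ h
    have := hw ζ hζ
    rw [h, sub_self, norm_zero] at this
    exact absurd this (not_lt.2 (norm_nonneg _))
  have hne : ∀ ζ ∈ sphere (0 : ℂ) R, p ζ ≠ w := by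
    intro ζ hζ h
    have := hw ζ hζ
    rw [h, norm_sub_rev] at this
    exact lt_irrefl _ this
  rw [← sub_eq_zero, windingIntegral, windingIntegral,
    ← circleIntegral.integral_sub (circleIntegrable_deriv_div hp h1 h2 hne)
      (circleIntegrable_deriv_div hp h1 h2 hne')]
  apply circleIntegral.integral_eq_zero_of_hasDerivWithinAt (by linarith)
    (f := fun ζ => Complex.log ((p ζ - w) / (p ζ - w')))
  intro ζ hζ
  have hd := hasDerivAt_of_mem_unitAnnulus hp (sphere_subset_unitAnnulus h1 h2 hζ)
  have a1 := sub_ne_zero.2 (hne ζ hζ)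
  have a2 := sub_ne_zero.2 (hne' ζ hζ)
  have hs : (p ζ - w) / (p ζ - w') ∈ slitPlane := by
    have : (p ζ - w) / (p ζ - w') = 1 + (w' - w) / (p ζ - w') := by
      field_simp; ring
    rw [this]
    apply mem_slitPlane_of_norm_lt_one
    rw [norm_div, div_lt_one (norm_pos_iff.2 a2)]
    exact hw ζ hζ
  have h3 := ((hd.sub_const w).div (hd.sub_const w') a2).clog hs
  refine HasDerivAt.hasDerivWithinAt (h3.congr_deriv ?_)
  simp only [Pi.div_apply]
  field_simp

theorem windingIntegral_eq_zero_of_norm_lt (hp : DifferentiableOn ℂ p (unitAnnulus R₀))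
    (h1 : 1 < R) (h2 : R < R₀) {w : ℂ}
    (hw : ∀ ζ ∈ sphere (0 : ℂ) R, ‖p ζ‖ < ‖w‖) : windingIntegral p R w = 0 := by
  apply circleIntegral.integral_eq_zero_of_hasDerivWithinAt (by linarith)
    (f := fun ζ => Complex.log (1 + (- p ζ / w)))
  intro ζ hζ
  have hw' := hw ζ hζ
  have hd := hasDerivAt_of_mem_unitAnnulus hp (sphere_subset_unitAnnulus h1 h2 hζ)
  have w0 : w ≠ 0 := norm_pos_iff.1 (lt_of_le_of_lt (norm_nonneg _) hw')
  have a1 : p ζ - w ≠ 0 := by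
    intro h
    rw [sub_eq_zero.1 h] at hw'
    exact lt_irrefl _ hw'
  have hs : 1 + (- p ζ / w) ∈ slitPlane := by
    apply mem_slitPlane_of_norm_lt_one
    rw [norm_div, norm_neg, div_lt_one (norm_pos_iff.2 w0)]
    exact hw'
  have h3 := ((hd.neg.div_const w).const_add 1).clog hs
  refine HasDerivAt.hasDerivWithinAt (h3.congr_deriv ?_)
  have a2 : w - p ζ ≠ 0 := by rwa [← neg_sub, neg_ne_zero]
  have a3 : 1 + -p ζ / w = (w - p ζ) / w := by
    field_simp
    ring
  simp only [Pi.neg_apply]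
  rw [a3]
  field_simp
  ring

theorem windingIntegral_eq_zero_of_isSimplyConnected
    (hp : DifferentiableOn ℂ p (unitAnnulus R₀)) (h1 : 1 < R) (h2 : R < R₀) {G : Set ℂ}
    (hG : IsOpen G) (hsc : IsSimplyConnected G) (hpG : MapsTo p (sphere 0 R) G) {w : ℂ}
    (hw : w ∉ G) : windingIntegral p R w = 0 := by
  obtain ⟨ℓ, hℓc, hℓ⟩ := Complex.exists_continuousOn_eqOn_exp_comp hsc hG
    (g := fun z => z - w) (by fun_prop) (by
      rintro ⟨z, hz, h0⟩
      exact hw (sub_eq_zero.1 h0 ▸ hz))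
  apply circleIntegral.integral_eq_zero_of_hasDerivWithinAt (by linarith)
    (f := fun ζ => ℓ (p ζ))
  intro ζ hζ
  have hd := hasDerivAt_of_mem_unitAnnulus hp (sphere_subset_unitAnnulus h1 h2 hζ)
  have hmem := hG.mem_nhds (hpG hζ)
  have hlog : HasDerivAt ℓ (p ζ - w)⁻¹ (p ζ) := by
    have he : HasDerivAt (fun u => Complex.exp u + w) (p ζ - w) (ℓ (p ζ)) := by
      have := (Complex.hasDerivAt_exp (ℓ (p ζ))).add_const w
      rwa [show Complex.exp (ℓ (p ζ)) = p ζ - w from hℓ (hpG hζ)] at this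
    refine HasDerivAt.of_local_left_inverse (hℓc.continuousAt hmem) he ?_ ?_
    · intro h
      exact hw (sub_eq_zero.1 h ▸ hpG hζ)
    · filter_upwards [hmem] with z hz
      have : Complex.exp (ℓ z) = z - w := hℓ hz
      simp [this]
  have h3 := hlog.comp ζ hd
  exact (h3.congr_deriv (by ring)).hasDerivWithinAt

theorem windingIntegral_sub_windingIntegral_of_deriv_ne_zero
    (hp : DifferentiableOn ℂ p (unitAnnulus R₀)) (hinj : InjOn p (unitAnnulus R₀)) {R' : ℝ}
    (h1 : 1 < R) (h2 : R' < R₀) {ζ₀ : ℂ} (hR : R < ‖ζ₀‖) (hR' : ‖ζ₀‖ < R')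
    (hd0 : deriv p ζ₀ ≠ 0) :
    windingIntegral p R' (p ζ₀) - windingIntegral p R (p ζ₀) = 2 * Real.pi * I := by
  have hopen := isOpen_unitAnnulus R₀
  have hζ₀ : ζ₀ ∈ unitAnnulus R₀ := ⟨by linarith, by linarith⟩
  have hq : DifferentiableOn ℂ (dslope p ζ₀) (unitAnnulus R₀) :=
    (Complex.differentiableOn_dslope (hopen.mem_nhds hζ₀)).2 hp
  have hne : ∀ ζ ∈ unitAnnulus R₀, dslope p ζ₀ ζ ≠ 0 := by
    intro ζ hζ
    by_cases h : ζ = ζ₀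
    · subst h; simpa using hd0
    · rw [dslope_of_ne _ h, slope_def_field]
      exact div_ne_zero (sub_ne_zero.2 fun e => h (hinj hζ hζ₀ e)) (sub_ne_zero.2 h)
  have hqd : DifferentiableOn ℂ (fun ζ => deriv (dslope p ζ₀) ζ / dslope p ζ₀ ζ)
      (unitAnnulus R₀) := (hq.deriv hopen).div hq hne
  have key : ∀ r, 1 < r → r < R₀ → r ≠ ‖ζ₀‖ → windingIntegral p r (p ζ₀) =
      (∮ ζ in C(0, r), (ζ - ζ₀)⁻¹) +
        ∮ ζ in C(0, r), deriv (dslope p ζ₀) ζ / dslope p ζ₀ ζ := by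
    intro r hr1 hr2 hr
    rw [windingIntegral, ← circleIntegral.integral_add]
    · apply circleIntegral.integral_congr (by linarith)
      intro ζ hζ
      have hζa := sphere_subset_unitAnnulus hr1 hr2 hζ
      have hζn : ζ ≠ ζ₀ := by
        rintro rfl
        exact hr (by simpa using hζ.symm)
      have e1 : p ζ - p ζ₀ = (ζ - ζ₀) * dslope p ζ₀ ζ := by
        simpa using (sub_smul_dslope p ζ₀ ζ).symm
      have e2 : deriv p ζ = dslope p ζ₀ ζ + (ζ - ζ₀) * deriv (dslope p ζ₀) ζ := by
        have : p = fun ζ => p ζ₀ + (ζ - ζ₀) * dslope p ζ₀ ζ := by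
          funext x
          have := sub_smul_dslope p ζ₀ x
          simp only [smul_eq_mul] at this
          rw [this]; ring
        have hdd := (hq.differentiableAt (hopen.mem_nhds hζa)).hasDerivAt
        have h4 := (((hasDerivAt_id ζ).sub_const ζ₀).mul hdd).const_add (p ζ₀)
        conv_lhs => rw [this]
        refine h4.deriv.trans ?_
        simp
      have h5 := hne ζ hζa
      have h6 := sub_ne_zero.2 hζn
      simp only [e1, e2]
      field_simp
    · rw [circleIntegrable_sub_inv_iff]
      right
      simpa [abs_of_pos (by linarith : 0 < r)] using hr.symm
    · exact (hqd.continuousOn.mono (sphere_subset_unitAnnulus hr1 hr2)).circleIntegrable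
        (by linarith)
  rw [key R' (by linarith) h2 (by linarith), key R h1 (by linarith) (by linarith)]
  have e1 : (∮ ζ in C(0, R'), (ζ - ζ₀)⁻¹) = 2 * Real.pi * I :=
    circleIntegral.integral_sub_inv_of_mem_ball (by simpa using hR')
  have e2 : (∮ ζ in C(0, R), (ζ - ζ₀)⁻¹) = 0 := by
    apply DiffContOnCl.circleIntegral_eq_zero (by linarith)
    apply DifferentiableOn.diffContOnCl
    intro ζ hζ
    have : ‖ζ‖ ≤ R := by simpa using closure_ball_subset_closedBall hζ
    have : ζ - ζ₀ ≠ 0 := sub_ne_zero.2 (by rintro rfl; linarith)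
    exact DifferentiableAt.differentiableWithinAt (by fun_prop (disch := assumption))
  have e3 : (∮ ζ in C(0, R'), deriv (dslope p ζ₀) ζ / dslope p ζ₀ ζ) =
      ∮ ζ in C(0, R), deriv (dslope p ζ₀) ζ / dslope p ζ₀ ζ := by
    apply Complex.circleIntegral_eq_of_differentiable_on_annulus_off_countable (by linarith)
      (by linarith) countable_empty
    · apply hqd.continuousOn.mono
      rintro ζ ⟨ha, hb⟩
      simp at ha hb
      exact ⟨by linarith, by linarith⟩
    · rintro ζ ⟨⟨ha, hb⟩, -⟩
      simp at ha hb
      exact hqd.differentiableAt (hopen.mem_nhds ⟨by linarith, by linarith⟩)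
  rw [e1, e2, e3]
  ring

theorem eventually_windingIntegral_eq (hp : DifferentiableOn ℂ p (unitAnnulus R₀))
    (h1 : 1 < R) (h2 : R < R₀) {w' : ℂ} (hw : w' ∉ p '' sphere 0 R) :
    ∀ᶠ w in 𝓝 w', windingIntegral p R w = windingIntegral p R w' := by
  have hc : IsClosed (p '' sphere 0 R) :=
    ((isCompact_sphere 0 R).image_of_continuousOn
      (continuousOn_sphere_of_differentiableOn hp h1 h2)).isClosed
  obtain ⟨ε, hε, hb⟩ := Metric.isOpen_iff.1 hc.isOpen_compl w' hw
  filter_upwards [ball_mem_nhds w' hε] with w hwε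
  apply windingIntegral_eq_of_norm_sub_lt hp h1 h2
  intro ζ hζ
  by_contra! hlt
  refine hb (a := p ζ) ?_ ⟨ζ, hζ, rfl⟩
  rw [mem_ball, dist_eq_norm] at hwε ⊢
  rw [norm_sub_rev] at hwε
  linarith

theorem windingIntegral_sub_windingIntegral
    (hp : DifferentiableOn ℂ p (unitAnnulus R₀)) (hinj : InjOn p (unitAnnulus R₀)) {R' : ℝ}
    (h1 : 1 < R) (h2 : R' < R₀) {ζ₀ : ℂ} (hR : R < ‖ζ₀‖) (hR' : ‖ζ₀‖ < R') :
    windingIntegral p R' (p ζ₀) - windingIntegral p R (p ζ₀) = 2 * Real.pi * I := by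
  have hζ₀ : ζ₀ ∈ unitAnnulus R₀ := ⟨by linarith, by linarith⟩
  have hnot : ∀ r, 1 < r → r < R₀ → r ≠ ‖ζ₀‖ → p ζ₀ ∉ p '' sphere 0 r := by
    rintro r hr1 hr2 hr ⟨ζ, hζ, e⟩
    rw [hinj (sphere_subset_unitAnnulus hr1 hr2 hζ) hζ₀ e] at hζ
    exact hr (by simpa using hζ.symm)
  have hcont : ContinuousAt p ζ₀ := (hasDerivAt_of_mem_unitAnnulus hp hζ₀).continuousAt
  have e1 := hcont.eventually (eventually_windingIntegral_eq hp h1 (by linarith)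
    (hnot R h1 (by linarith) (by linarith)))
  have e2 := hcont.eventually (eventually_windingIntegral_eq hp (by linarith) h2
    (hnot R' (by linarith) h2 (by linarith)))
  have e3 : ∀ᶠ ζ in 𝓝 ζ₀, R < ‖ζ‖ := continuous_norm.continuousAt.eventually (lt_mem_nhds hR)
  have e4 : ∀ᶠ ζ in 𝓝 ζ₀, ‖ζ‖ < R' := continuous_norm.continuousAt.eventually (gt_mem_nhds hR')
  have e5 : ∃ᶠ ζ in 𝓝 ζ₀, deriv p ζ ≠ 0 := by
    intro hev
    have hev' : ∀ᶠ ζ in 𝓝 ζ₀, deriv p ζ = 0 ∧ ζ ∈ unitAnnulus R₀ := by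
      filter_upwards [hev, (isOpen_unitAnnulus R₀).mem_nhds hζ₀] with ζ h h'
      exact ⟨not_not.1 h, h'⟩
    obtain ⟨ε, hε, hb⟩ := Metric.eventually_nhds_iff_ball.1 hev'
    have hx : ζ₀ + (ε / 2 : ℝ) ∈ ball ζ₀ ε := by
      simp [abs_of_pos hε]; linarith
    have := isOpen_ball.is_const_of_deriv_eq_zero (convex_ball ζ₀ ε).isPreconnected
      (hp.mono fun ζ h => (hb ζ h).2) (fun ζ h => (hb ζ h).1) (mem_ball_self hε) hx
    have := hinj hζ₀ (hb _ hx).2 this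
    simp at this
    linarith
  obtain ⟨ζ, hd, ha, hb, hc, hd'⟩ := (e5.and_eventually (e1.and (e2.and (e3.and e4)))).exists
  rw [← ha, ← hb]
  exact windingIntegral_sub_windingIntegral_of_deriv_ne_zero hp hinj h1 h2 hc hd' hd

/-- If the winding numbers of the image circles around image points further out vanish, the
image of a punctured neighbourhood of the inner boundary is relatively compact in any simply
connected domain containing the image of the annulus. -/
theorem isCompact_closure_image_unitAnnulus
    (hp : DifferentiableOn ℂ p (unitAnnulus R₀)) (hinj : InjOn p (unitAnnulus R₀))
    (h1 : 1 < R) (h2 : R < R₀) {G : Set ℂ}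
    (hG : IsOpen G) (hsc : IsSimplyConnected G) (hpG : MapsTo p (unitAnnulus R₀) G)
    (hzero : ∀ r, 1 < r → r < R₀ → ∀ ζ ∈ unitAnnulus R₀, r < ‖ζ‖ →
      windingIntegral p r (p ζ) = 0) :
    IsCompact (closure (p '' unitAnnulus R)) ∧ closure (p '' unitAnnulus R) ⊆ G := by
  have hval : ∀ w ∈ p '' unitAnnulus R, windingIntegral p R w ≠ 0 := by
    rintro _ ⟨ζ, ⟨ha, hb⟩, rfl⟩
    obtain ⟨r, hr1, hr2⟩ := exists_between ha
    have hj := windingIntegral_sub_windingIntegral hp hinj hr1 h2 hr2 hb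
    rw [hzero r hr1 (by linarith) ζ ⟨ha, by linarith⟩ hr2, sub_zero] at hj
    rw [hj]
    exact two_pi_I_ne_zero
  have hcpt : IsCompact (p '' sphere 0 R) := (isCompact_sphere 0 R).image_of_continuousOn
      (continuousOn_sphere_of_differentiableOn hp h1 h2)
  constructor
  · obtain ⟨B, hB⟩ := hcpt.isBounded.exists_norm_le
    apply Bornology.IsBounded.isCompact_closure
    refine (isBounded_closedBall (x := (0 : ℂ)) (r := B)).subset fun w hw => ?_
    rw [mem_closedBall_zero_iff]
    by_contra! hlt
    exact hval w hw (windingIntegral_eq_zero_of_norm_lt hp h1 h2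
      fun ζ hζ => (hB _ ⟨ζ, hζ, rfl⟩).trans_lt hlt)
  · intro w hw
    by_cases hws : w ∈ p '' sphere 0 R
    · obtain ⟨ζ, hζ, rfl⟩ := hws
      exact hpG (sphere_subset_unitAnnulus h1 h2 hζ)
    · by_contra hwG
      obtain ⟨w', hw', he⟩ := ((mem_closure_iff_frequently.1 hw).and_eventually
        (eventually_windingIntegral_eq hp h1 h2 hws)).exists
      exact hval w' hw' (he.trans (windingIntegral_eq_zero_of_isSimplyConnected hp h1 h2 hG hsc
        (hpG.mono_left (sphere_subset_unitAnnulus h1 h2)) hwG))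

end Winding

section Joukowski

/-- The Joukowski map taking the exterior of the unit disc onto the complement of the
horizontal segment from `xl + iy` to `xr + iy`. -/
def joukowski (y xl xr : ℝ) (ζ : ℂ) : ℂ :=
  (((xl + xr) / 2 : ℝ) + y * I) + ((xr - xl) / 4 : ℝ) * (ζ + ζ⁻¹)

/-- The sum of the distances to the endpoints of the segment from `xl + iy` to `xr + iy`. -/
def fociDist (y xl xr : ℝ) (z : ℂ) : ℝ := ‖z - (xl + y * I)‖ + ‖z - (xr + y * I)‖

variable {y xl xr : ℝ}

theorem continuous_fociDist : Continuous (fociDist y xl xr) := by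
  unfold fociDist; fun_prop

theorem fociDist_joukowski (h : xl < xr) {ζ : ℂ} (hζ : ζ ≠ 0) :
    fociDist y xl xr (joukowski y xl xr ζ) = (xr - xl) / 2 * (‖ζ‖ + ‖ζ‖⁻¹) := by
  have e1 : joukowski y xl xr ζ - (xl + y * I) = ((xr - xl) / 4 : ℝ) * ((ζ + 1) ^ 2 / ζ) := by
    unfold joukowski; push_cast; field_simp; ring
  have e2 : joukowski y xl xr ζ - (xr + y * I) = ((xr - xl) / 4 : ℝ) * ((ζ - 1) ^ 2 / ζ) := by
    unfold joukowski; push_cast; field_simp; ring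
  have hn : ‖ζ‖ ≠ 0 := norm_ne_zero_iff.2 hζ
  have hpar : ‖ζ + 1‖ ^ 2 + ‖ζ - 1‖ ^ 2 = 2 * (‖ζ‖ ^ 2 + 1) := by
    have := parallelogram_law_with_norm ℝ ζ 1
    simp only [norm_one] at this
    linarith
  rw [fociDist, e1, e2, norm_mul, norm_mul, norm_div, norm_div, norm_pow, norm_pow,
    Complex.norm_of_nonneg (by linarith)]
  field_simp
  linear_combination 2 * (xr - xl) * hpar

theorem joukowski_injOn (h : xl < xr) : InjOn (joukowski y xl xr) {ζ | 1 < ‖ζ‖} := by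
  intro ζ hζ η hη e
  simp only [mem_ofPred_eq] at hζ hη
  have h1 : ζ ≠ 0 := norm_pos_iff.1 (by linarith)
  have h2 : η ≠ 0 := norm_pos_iff.1 (by linarith)
  have ha : (((xr - xl) / 4 : ℝ) : ℂ) ≠ 0 := by
    norm_cast; linarith
  have e' : ζ + ζ⁻¹ = η + η⁻¹ := by
    unfold joukowski at e
    exact mul_left_cancel₀ ha (add_left_cancel e)
  have e'' : (ζ - η) * (ζ * η - 1) = 0 := by
    field_simp at e'
    linear_combination e'
  rcases mul_eq_zero.1 e'' with h3 | h3
  · exact sub_eq_zero.1 h3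
  · have : ‖ζ‖ * ‖η‖ = 1 := by rw [← norm_mul, sub_eq_zero.1 h3, norm_one]
    nlinarith

theorem exists_joukowski_eq (h : xl < xr) {z : ℂ} (hz : xr - xl < fociDist y xl xr z) :
    ∃ ζ : ℂ, 1 < ‖ζ‖ ∧ joukowski y xl xr ζ = z := by
  have ha : (((xr - xl) / 4 : ℝ) : ℂ) ≠ 0 := by
    norm_cast; linarith
  set v : ℂ := (z - (((xl + xr) / 2 : ℝ) + y * I)) / ((xr - xl) / 4 : ℝ) with hv
  obtain ⟨s, hs⟩ : ∃ s : ℂ, s ^ 2 = v ^ 2 / 4 - 1 := 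
    IsAlgClosed.exists_pow_nat_eq (v ^ 2 / 4 - 1) two_pos
  have hprod : (v / 2 + s) * (v / 2 - s) = 1 := by linear_combination -hs
  have h0 : v / 2 + s ≠ 0 := left_ne_zero_of_mul_eq_one hprod
  have hinv : (v / 2 + s)⁻¹ = v / 2 - s := inv_eq_of_mul_eq_one_right hprod
  have hJ : joukowski y xl xr (v / 2 + s) = z := by
    rw [joukowski, hinv, hv]
    field_simp
    ring
  have hJ' : joukowski y xl xr (v / 2 + s)⁻¹ = z := by
    rw [← hJ, joukowski, joukowski, inv_inv, add_comm (v / 2 + s)]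
  rcases lt_trichotomy ‖v / 2 + s‖ 1 with hl | hl | hl
  · exact ⟨_, by rw [norm_inv]; exact (one_lt_inv₀ (norm_pos_iff.2 h0)).2 hl, hJ'⟩
  · rw [← hJ, fociDist_joukowski h h0, hl] at hz
    norm_num at hz
  · exact ⟨_, hl, hJ⟩

theorem differentiableOn_joukowski : DifferentiableOn ℂ (joukowski y xl xr) {ζ | 1 < ‖ζ‖} := by
  intro ζ hζ
  simp only [mem_ofPred_eq] at hζ
  have h1 : ζ ≠ 0 := norm_pos_iff.1 (by linarith)
  unfold joukowski
  exact DifferentiableAt.differentiableWithinAt (by fun_prop (disch := assumption))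

theorem abs_joukowski_im_sub_le (h : xl < xr) {ζ : ℂ} (hζ : 1 < ‖ζ‖) :
    |(joukowski y xl xr ζ).im - y| ≤ (xr - xl) / 4 * (‖ζ‖ - ‖ζ‖⁻¹) := by
  have h0 : ‖ζ‖ ≠ 0 := by linarith
  have e : (joukowski y xl xr ζ).im - y = (xr - xl) / 4 * (ζ.im * (1 - (‖ζ‖ ^ 2)⁻¹)) := by
    simp [joukowski, Complex.inv_im, Complex.normSq_eq_norm_sq, -ofReal_div, -ofReal_sub,
      -ofReal_add]
    left; ring
  have h1 : (‖ζ‖ ^ 2)⁻¹ ≤ 1 := inv_le_one_of_one_le₀ (by nlinarith)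
  rw [e, abs_mul, abs_mul, abs_of_pos (by linarith : 0 < (xr - xl) / 4),
    abs_of_nonneg (by linarith : 0 ≤ 1 - (‖ζ‖ ^ 2)⁻¹)]
  have h2 := Complex.abs_im_le_norm ζ
  have h3 : ‖ζ‖ - ‖ζ‖⁻¹ = ‖ζ‖ * (1 - (‖ζ‖ ^ 2)⁻¹) := by field_simp
  rw [h3]
  gcongr

theorem xr_sub_xl_lt_fociDist_joukowski (h : xl < xr) {ζ : ℂ} (hζ : 1 < ‖ζ‖) :
    xr - xl < fociDist y xl xr (joukowski y xl xr ζ) := by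
  have h0 : ζ ≠ 0 := norm_pos_iff.1 (by linarith)
  rw [fociDist_joukowski h h0]
  have : 0 < ‖ζ‖ + ‖ζ‖⁻¹ - 2 := by
    have : ‖ζ‖ + ‖ζ‖⁻¹ - 2 = (‖ζ‖ - 1) ^ 2 / ‖ζ‖ := by field_simp; ring
    rw [this]
    have : 0 < ‖ζ‖ - 1 := by linarith
    positivity
  nlinarith

theorem strictMono_add_inv {r s : ℝ} (hr : 1 ≤ r) (hrs : r < s) : r + r⁻¹ < s + s⁻¹ := by
  have hr0 : 0 < r := by linarith
  have hs0 : 0 < s := by linarith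
  have : s + s⁻¹ - (r + r⁻¹) = (s - r) * (r * s - 1) / (r * s) := by
    field_simp; ring
  have : 0 < s + s⁻¹ - (r + r⁻¹) := by
    rw [this]
    have : 0 < r * s - 1 := by nlinarith
    have : 0 < s - r := by linarith
    positivity
  linarith

theorem lt_fociDist_joukowski_iff (h : xl < xr) {ζ : ℂ} {r : ℝ} (hr : 1 < r) (hζ : 1 < ‖ζ‖) :
    (xr - xl) / 2 * (r + r⁻¹) < fociDist y xl xr (joukowski y xl xr ζ) ↔ r < ‖ζ‖ := by
  rw [fociDist_joukowski h (norm_pos_iff.1 (by linarith)),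
    mul_lt_mul_iff_of_pos_left (by linarith)]
  constructor
  · intro hlt
    by_contra! hle
    rcases hle.lt_or_eq with h3 | h3
    · exact absurd (strictMono_add_inv hζ.le h3) (by linarith)
    · rw [h3] at hlt; exact lt_irrefl _ hlt
  · exact strictMono_add_inv hr.le

/-- The segment is the degenerate ellipse with foci at its endpoints. -/
theorem mem_segment_iff_fociDist (z : ℂ) :
    (z.im = y ∧ z.re ∈ Icc xl xr) ↔ fociDist y xl xr z ≤ xr - xl := by
  constructor
  · rintro ⟨hy, ha, hb⟩
    have e1 : z - (xl + y * I) = ((z.re - xl : ℝ) : ℂ) := by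
      apply Complex.ext <;> simp [hy]
    have e2 : z - (xr + y * I) = ((z.re - xr : ℝ) : ℂ) := by
      apply Complex.ext <;> simp [hy]
    rw [fociDist, e1, e2, Complex.norm_real, Complex.norm_real, Real.norm_of_nonneg (by linarith),
      Real.norm_of_nonpos (by linarith)]
    linarith
  · intro hle
    have h1 := Complex.abs_re_le_norm (z - (xl + y * I))
    have h2 := Complex.abs_re_le_norm (z - (xr + y * I))
    unfold fociDist at hle
    simp at h1 h2
    have h3 := abs_le.1 h1
    have h4 := abs_le.1 h2
    have hre : z.re ∈ Icc xl xr := ⟨by linarith, by linarith⟩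
    refine ⟨?_, hre⟩
    have h5 := le_abs_self (z.re - xl)
    have h6 := neg_le_abs (z.re - xr)
    have h7 : ‖z - (xl + y * I)‖ = z.re - xl := by linarith
    have h8 : ‖z - (xl + y * I)‖ ^ 2 = (z.re - xl) ^ 2 + (z.im - y) ^ 2 := by
      rw [Complex.sq_norm, Complex.normSq_apply]; simp; ring
    rw [h7] at h8
    have : (z.im - y) ^ 2 = 0 := by linarith
    have := pow_eq_zero_iff (two_ne_zero) |>.1 this
    linarith

theorem convex_fociDist_le (c : ℝ) : Convex ℝ {z | fociDist y xl xr z ≤ c} := by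
  have h : ConvexOn ℝ univ (fociDist y xl xr) := by
    have key (w : ℂ) : ConvexOn ℝ univ fun z : ℂ => ‖z - w‖ := by
      simpa [dist_eq_norm] using convexOn_univ_dist w
    exact (key _).add (key _)
  simpa using h.convex_le c

theorem isBounded_fociDist_le (c : ℝ) : IsBounded {z | fociDist y xl xr z ≤ c} := by
  refine (isBounded_closedBall (x := (xl + y * I : ℂ)) (r := c)).subset fun z hz => ?_
  rw [mem_closedBall, dist_eq_norm]
  have h1 : ‖z - (xl + y * I)‖ + ‖z - (xr + y * I)‖ ≤ c := hz
  have h2 := norm_nonneg (z - (xr + y * I))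
  linarith

theorem isCompact_fociDist_le (c : ℝ) : IsCompact {z | fociDist y xl xr z ≤ c} :=
  Metric.isCompact_of_isClosed_isBounded (isClosed_le continuous_fociDist continuous_const)
    (isBounded_fociDist_le c)

/-- Thin ellipses around the segment lie in any given open neighbourhood of it. -/
theorem exists_fociDist_lt_subset {O : Set ℂ} (hO : IsOpen O)
    (hCO : {z | fociDist y xl xr z ≤ xr - xl} ⊆ O) :
    ∃ R₀ > 1, {z | fociDist y xl xr z < (xr - xl) / 2 * (R₀ + R₀⁻¹)} ⊆ O := by
  have hK : IsCompact ({z | fociDist y xl xr z ≤ xr - xl + 1} \ O) :=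
    (isCompact_fociDist_le _).diff hO
  obtain ⟨c, hc, hcO⟩ : ∃ c > xr - xl, {z | fociDist y xl xr z < c} ⊆ O := by
    rcases ({z | fociDist y xl xr z ≤ xr - xl + 1} \ O).eq_empty_or_nonempty with he | hne
    · refine ⟨xr - xl + 1, by linarith, fun z hz => ?_⟩
      have : fociDist y xl xr z < xr - xl + 1 := hz
      exact sdiff_eq_empty.1 he this.le
    · obtain ⟨z₀, hz₀, hmin⟩ := hK.exists_isMinOn hne continuous_fociDist.continuousOn
      refine ⟨fociDist y xl xr z₀, ?_, fun z hz => ?_⟩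
      · by_contra! hle
        exact hz₀.2 (hCO hle)
      · by_contra hzO
        have hz' : fociDist y xl xr z < fociDist y xl xr z₀ := hz
        have h2 : fociDist y xl xr z₀ ≤ xr - xl + 1 := hz₀.1
        exact absurd (hmin ⟨(by simp only [mem_ofPred_eq]; linarith), hzO⟩) (not_le.2 hz')
  have ht : Tendsto (fun r : ℝ => (xr - xl) / 2 * (r + r⁻¹)) (𝓝[>] 1)
      (𝓝 ((xr - xl) / 2 * (1 + 1⁻¹))) := by
    apply tendsto_nhdsWithin_of_tendsto_nhds
    apply ContinuousAt.tendsto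
    fun_prop (disch := norm_num)
  have hev : ∀ᶠ r in 𝓝[>] (1 : ℝ), (xr - xl) / 2 * (r + r⁻¹) < c :=
    ht.eventually (gt_mem_nhds (by norm_num; linarith))
  obtain ⟨r, hr, hr1⟩ := (hev.and self_mem_nhdsWithin).exists
  exact ⟨r, hr1, fun z hz => hcO (lt_trans hz hr)⟩

end Joukowski

section SlitDomain

theorem isBounded_iUnion_of_isHorizontalSlit {ι : Type*} [Finite ι] {C : ι → Set ℂ}
    (hC : ∀ j, IsHorizontalSlit (C j)) : IsBounded (⋃ j, C j) := by
  refine isBounded_iUnion.2 fun j => ?_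
  obtain ⟨y, xl, xr, hy, hx, e⟩ := hC j
  refine (isBounded_fociDist_le (y := y) (xl := xl) (xr := xr) (xr - xl)).subset fun z hz => ?_
  rw [e] at hz
  exact (mem_segment_iff_fociDist z).1 hz

/-- Removing finitely many horizontal slits and a bounded convex set from the upper half-plane
leaves a connected set. -/
theorem isPreconnected_UHP_diff {ι : Type*} [Finite ι] {C : ι → Set ℂ}
    (hC : ∀ j, IsHorizontalSlit (C j)) {E : Set ℂ} (hE : Convex ℝ E) (hEb : IsBounded E)
    (hopen : IsOpen ((UHP \ ⋃ j, C j) \ E)) : IsPreconnected ((UHP \ ⋃ j, C j) \ E) := by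
  obtain ⟨M, hM⟩ := ((isBounded_iUnion_of_isHorizontalSlit hC).union hEb).exists_norm_le
  have hav : ∀ z : ℂ, 0 < z.im → M < ‖z‖ → z ∈ (UHP \ ⋃ j, C j) \ E := by
    intro z hz hn
    exact ⟨⟨hz, fun h => absurd (hM z (Or.inl h)) (not_le.2 hn)⟩,
      fun h => absurd (hM z (Or.inr h)) (not_le.2 hn)⟩
  set U := (UHP \ ⋃ j, C j) \ E with hU
  set b : ℂ := (|M| + 1 : ℝ) * I with hb
  have hbim : b.im = |M| + 1 := by simp [hb]
  have hMabs := le_abs_self M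
  have hM0 := abs_nonneg M
  let T₁ : Set ℂ := {z | 0 < z.im} ∩ {z | z.re < -|M|}
  let T₂ : Set ℂ := {z | 0 < z.im} ∩ {z | |M| < z.re}
  let T₃ : Set ℂ := {z | |M| < z.im}
  have c₁ : Convex ℝ T₁ := (convex_halfSpace_im_gt 0).inter (convex_halfSpace_re_lt _)
  have c₂ : Convex ℝ T₂ := (convex_halfSpace_im_gt 0).inter (convex_halfSpace_re_gt _)
  have c₃ : Convex ℝ T₃ := convex_halfSpace_im_gt _
  have s₁ : T₁ ⊆ U := fun z hz => hav z hz.1 (by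
    have h1 := Complex.abs_re_le_norm z
    have h2 := neg_le_abs z.re
    have h3 : z.re < -|M| := hz.2
    linarith)
  have s₂ : T₂ ⊆ U := fun z hz => hav z hz.1 (by
    have h1 := Complex.abs_re_le_norm z
    have h2 := le_abs_self z.re
    have h3 : |M| < z.re := hz.2
    linarith)
  have s₃ : T₃ ⊆ U := fun z hz => hav z (lt_of_le_of_lt hM0 hz) (by
    have h1 := Complex.abs_im_le_norm z
    have h2 := le_abs_self z.im
    have h3 : |M| < z.im := hz
    linarith)
  have b₃ : b ∈ T₃ := by simp only [T₃, mem_ofPred_eq, hbim]; linarith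
  have k₁ : IsPreconnected (T₁ ∪ T₃) := by
    refine c₁.isPreconnected.union' ⟨⟨-|M| - 1, |M| + 1⟩, ⟨?_, ?_⟩, ?_⟩ c₃.isPreconnected <;>
      (simp [T₃]; try linarith)
  have k₂ : IsPreconnected (T₂ ∪ T₃) := by
    refine c₂.isPreconnected.union' ⟨⟨|M| + 1, |M| + 1⟩, ⟨?_, ?_⟩, ?_⟩ c₃.isPreconnected <;>
      (simp [T₃]; try linarith)
  apply isPreconnected_of_forall b
  intro z hz
  obtain ⟨ε, hε, hball⟩ := Metric.isOpen_iff.1 hopen z hz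
  choose! yy xl xr hyy hx hCe using hC
  obtain ⟨y, ⟨hy1, hy2⟩, hyn⟩ : (Ioo z.im (z.im + ε) \ range yy).Nonempty :=
    ((Ioo_infinite (by linarith)).sdiff (finite_range yy)).nonempty
  have hzim : 0 < z.im := hz.1.1
  have hline : ∀ w : ℂ, w.im = y → w ∉ ⋃ j, C j := by
    rintro w hw hmem
    obtain ⟨j, hj⟩ := mem_iUnion.1 hmem
    rw [hCe j] at hj
    exact hyn ⟨j, by rw [← hw]; exact hj.1.symm⟩
  set z' : ℂ := ⟨z.re, y⟩ with hz'
  have hz'b : z' ∈ ball z ε := by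
    have : z' - z = ((y - z.im : ℝ) : ℂ) * I := by apply Complex.ext <;> simp [hz']
    rw [mem_ball, dist_eq_norm, this, norm_mul, Complex.norm_real, norm_I, mul_one,
      Real.norm_of_nonneg (by linarith)]
    linarith
  let L₁ : Set ℂ := {w | w.im = y} ∩ {w | w.re ≤ z.re}
  let L₂ : Set ℂ := {w | w.im = y} ∩ {w | z.re ≤ w.re}
  have cL₁ : Convex ℝ L₁ := (convex_hyperplane Complex.imLm.isLinear _).inter
    (convex_halfSpace_re_le _)
  have cL₂ : Convex ℝ L₂ := (convex_hyperplane Complex.imLm.isLinear _).inter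
    (convex_halfSpace_re_ge _)
  have hray : Disjoint L₁ E ∨ Disjoint L₂ E := by
    by_contra! hcon
    obtain ⟨w₁, ⟨hw₁, hw₁'⟩, he₁⟩ := not_disjoint_iff.1 hcon.1
    obtain ⟨w₂, ⟨hw₂, hw₂'⟩, he₂⟩ := not_disjoint_iff.1 hcon.2
    simp only [mem_ofPred_eq] at hw₁ hw₁' hw₂ hw₂'
    refine (hball hz'b).2 (hE.segment_subset he₁ he₂ ?_)
    rcases eq_or_lt_of_le (hw₁'.trans hw₂') with h0 | h0
    · have : z' = w₁ := by apply Complex.ext <;> simp [hz'] <;> linarith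
      rw [this]; exact left_mem_segment _ _ _
    · refine ⟨(w₂.re - z.re) / (w₂.re - w₁.re), (z.re - w₁.re) / (w₂.re - w₁.re),
        div_nonneg (by linarith) (by linarith), div_nonneg (by linarith) (by linarith), ?_, ?_⟩
      · have : w₂.re - w₁.re ≠ 0 := by linarith
        field_simp; ring
      · have : w₂.re - w₁.re ≠ 0 := by linarith
        apply Complex.ext
        · rw [Complex.add_re, Complex.smul_re, Complex.smul_re]
          simp only [hz', smul_eq_mul]
          field_simp
          ring
        · rw [Complex.add_im, Complex.smul_im, Complex.smul_im]
          simp only [hz', hw₁, hw₂, smul_eq_mul]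
          field_simp
          ring
  have join : ∀ L T : Set ℂ, Convex ℝ L → z' ∈ L → (∀ w ∈ L, w.im = y) → Disjoint L E →
      IsPreconnected (T ∪ T₃) → T ⊆ U → (L ∩ T).Nonempty →
      ∃ t ⊆ U, b ∈ t ∧ z ∈ t ∧ IsPreconnected t := by
    intro L T hL hzL hLy hd hT hTU ⟨v, hvL, hvT⟩
    refine ⟨ball z ε ∪ (L ∪ (T ∪ T₃)), ?_, ?_, Or.inl (mem_ball_self hε), ?_⟩
    · refine union_subset hball (union_subset (fun w hw => ?_) (union_subset hTU s₃))
      refine ⟨⟨?_, hline w (hLy w hw)⟩, disjoint_left.1 hd hw⟩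
      change 0 < w.im
      rw [hLy w hw]; linarith
    · exact Or.inr (Or.inr (Or.inr b₃))
    · exact (convex_ball z ε).isPreconnected.union' ⟨z', hz'b, Or.inl hzL⟩
        (hL.isPreconnected.union' ⟨v, hvL, Or.inl hvT⟩ hT)
  have ypos : 0 < y := by linarith
  rcases hray with hd | hd
  · refine join L₁ T₁ cL₁ (by simp [L₁, hz']) (fun w hw => hw.1) hd k₁ s₁
      ⟨⟨min z.re (-|M| - 1), y⟩, ⟨by simp, by simp⟩, by simpa using ypos, ?_⟩
    have := min_le_right z.re (-|M| - 1)
    simp only [mem_ofPred_eq]; linarith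
  · refine join L₂ T₂ cL₂ (by simp [L₂, hz']) (fun w hw => hw.1) hd k₂ s₂
      ⟨⟨max z.re (|M| + 1), y⟩, ⟨by simp, by simp⟩, by simpa using ypos, ?_⟩
    have := le_max_right z.re (|M| + 1)
    simp only [mem_ofPred_eq]; linarith

end SlitDomain

section SlitBoundary

/-- A preconnected set of reals covered by `N` intervals of length `2δ` has diameter at most
`2Nδ`. -/
theorem abs_sub_le_of_isPreconnected_of_subset_iUnion_ball {κ : Type*} [Fintype κ] {S : Set ℝ}
    (hS : IsPreconnected S) {c : κ → ℝ} {δ : ℝ} (hSc : S ⊆ ⋃ k, ball (c k) δ) {a b : ℝ}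
    (ha : a ∈ S) (hb : b ∈ S) : |a - b| ≤ Fintype.card κ * (2 * δ) := by
  wlog hab : a ≤ b generalizing a b
  · rw [abs_sub_comm]; exact this hb ha (le_of_not_ge hab)
  rcases le_or_gt δ 0 with hδ | hδ
  · obtain ⟨k, hk⟩ := mem_iUnion.1 (hSc ha)
    rw [ball_eq_empty.2 hδ] at hk
    exact hk.elim
  have h1 : Icc a b ⊆ ⋃ k, ball (c k) δ := (hS.ordConnected.out ha hb).trans hSc
  have h2 : volume (Icc a b) ≤ ∑ k, volume (ball (c k) δ) :=
    (measure_mono h1).trans (measure_iUnion_fintype_le _ _)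
  simp only [Real.volume_Icc, Real.volume_ball, Finset.sum_const, Finset.card_univ,
    nsmul_eq_mul] at h2
  rw [← ENNReal.ofReal_natCast, ← ENNReal.ofReal_mul (by positivity),
    ENNReal.ofReal_le_ofReal_iff (by positivity)] at h2
  rw [abs_sub_comm, abs_of_nonneg (by linarith)]
  exact h2

/-- The circle averages of a holomorphic function on an annulus do not depend on the radius. -/
theorem circleAverage_eq_of_differentiableOn_unitAnnulus {g : ℂ → ℂ} {R₀ : ℝ}
    (hg : DifferentiableOn ℂ g (unitAnnulus R₀)) {r R : ℝ} (hr : 1 < r) (hr' : r < R₀)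
    (hR : 1 < R) (hR' : R < R₀) :
    Real.circleAverage g 0 r = Real.circleAverage g 0 R := by
  wlog hle : r ≤ R generalizing r R
  · exact (this hR hR' hr hr' (le_of_not_ge hle)).symm
  rw [Real.circleAverage_eq_circleIntegral (by linarith),
    Real.circleAverage_eq_circleIntegral (by linarith)]
  congr 1
  refine (Complex.circleIntegral_sub_center_inv_smul_eq_of_differentiable_on_annulus_off_countable
    (by linarith) hle countable_empty ?_ ?_).symm
  · refine hg.continuousOn.mono fun z hz => ?_
    have h1 : ‖z‖ ≤ R := by simpa using hz.1
    have h2 : r ≤ ‖z‖ := by simpa using hz.2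
    exact ⟨by linarith, by linarith⟩
  · intro z hz
    have h1 : ‖z‖ < R := by simpa using hz.1.1
    have h2 : r < ‖z‖ := by simpa using hz.1.2
    exact hg.differentiableAt ((isOpen_unitAnnulus R₀).mem_nhds ⟨by linarith, by linarith⟩)

theorem isClosed_of_isHorizontalSlit {C : Set ℂ} (h : IsHorizontalSlit C) : IsClosed C := by
  obtain ⟨y, xl, xr, -, -, rfl⟩ := h
  exact (isClosed_eq continuous_im continuous_const).inter
    (isClosed_Icc.preimage continuous_re)

theorem isOpen_UHP : IsOpen UHP := isOpen_lt continuous_const continuous_im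

theorem isOpen_UHP_diff_iUnion {ι : Type*} [Finite ι] {C : ι → Set ℂ}
    (hC : ∀ j, IsHorizontalSlit (C j)) : IsOpen (UHP \ ⋃ j, C j) :=
  isOpen_UHP.sdiff (isClosed_iUnion_of_finite fun j => isClosed_of_isHorizontalSlit (hC j))

/-- High points of the imaginary axis are moved by less than `1`. -/
theorem SatisfiesH1.exists_norm_sub_lt {D : Set ℂ} {f : ℂ → ℂ} (h : SatisfiesH1 D f) {ε : ℝ}
    (hε : 0 < ε) (M : ℝ) : ∃ z ∈ D, M < ‖z‖ ∧ ‖f z - z‖ < ε := by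
  obtain ⟨η, hη, hD, ht⟩ := h
  have hY : Tendsto (fun Y : ℝ => (Y : ℂ) * I) atTop (cobounded ℂ ⊓ 𝓟 (HP η)) := by
    refine tendsto_inf.2 ⟨?_, tendsto_principal.2 ?_⟩
    · rw [← tendsto_norm_atTop_iff_cobounded]
      simpa using tendsto_abs_atTop_atTop
    · filter_upwards [eventually_gt_atTop η] with Y hY
      simpa [HP] using hY
  have h1 := (ht.comp hY).eventually (Metric.ball_mem_nhds (0 : ℂ) hε)
  obtain ⟨Y, hY1, hY2, hY3⟩ :=
    (h1.and ((eventually_gt_atTop η).and (eventually_gt_atTop M))).exists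
  refine ⟨Y * I, hD (by simpa [HP] using hY2), ?_, by simpa using hY1⟩
  simpa using lt_of_lt_of_le hY3 (le_abs_self Y)

variable {ι : Type*} [Finite ι] {C : ι → Set ℂ} {f : ℂ → ℂ} {y xl xr R₀ : ℝ}

theorem windingIntegral_comp_joukowski_eq_zero (hC : ∀ j, IsHorizontalSlit (C j))
    (hf : DifferentiableOn ℂ f (UHP \ ⋃ j, C j)) (hinj : InjOn f (UHP \ ⋃ j, C j))
    (h1 : SatisfiesH1 (UHP \ ⋃ j, C j) f) (hx : xl < xr)
    (hJ : MapsTo (joukowski y xl xr) (unitAnnulus R₀) (UHP \ ⋃ j, C j))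
    {r : ℝ} (hr : 1 < r) (hr' : r < R₀) {ζ : ℂ} (hζ : ζ ∈ unitAnnulus R₀) (hrζ : r < ‖ζ‖) :
    windingIntegral (f ∘ joukowski y xl xr) r (f (joukowski y xl xr ζ)) = 0 := by
  set D := UHP \ ⋃ j, C j with hD
  set E := {z | fociDist y xl xr z ≤ (xr - xl) / 2 * (r + r⁻¹)} with hE
  set p := f ∘ joukowski y xl xr with hpdef
  have hp : DifferentiableOn ℂ p (unitAnnulus R₀) :=
    hf.comp (differentiableOn_joukowski.mono fun ζ hζ => hζ.1) hJ
  have hDo : IsOpen D := isOpen_UHP_diff_iUnion hC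
  have hEo : IsOpen (D \ E) :=
    hDo.sdiff (isClosed_le continuous_fociDist continuous_const)
  have hpre : IsPreconnected (D \ E) :=
    isPreconnected_UHP_diff hC (convex_fociDist_le _) (isBounded_fociDist_le _) hEo
  have hnot : ∀ z ∈ D \ E, f z ∉ p '' sphere 0 r := by
    rintro z ⟨hzD, hzE⟩ ⟨ξ, hξ, e⟩
    have hξ' := sphere_subset_unitAnnulus hr hr' hξ
    have := hinj (hJ hξ') hzD e
    rw [← this] at hzE
    have h3 := (lt_fociDist_joukowski_iff hx hr hξ'.1).1 (not_le.1 hzE)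
    have h4 : ‖ξ‖ = r := by simpa using hξ
    linarith
  have hloc : ∀ z ∈ D \ E, (fun w => windingIntegral p r (f w)) =ᶠ[𝓝 z]
      fun _ => windingIntegral p r (f z) := fun z hz =>
    ((hf.differentiableAt (hDo.mem_nhds hz.1)).continuousAt.eventually
      (eventually_windingIntegral_eq hp hr hr' (hnot z hz)))
  have hconst : ∀ z ∈ D \ E, ∀ w ∈ D \ E,
      windingIntegral p r (f z) = windingIntegral p r (f w) := by
    intro z hz w hw
    refine hEo.is_const_of_deriv_eq_zero (𝕜 := ℂ) (f := fun w => windingIntegral p r (f w)) hpre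
      (fun v hv => ?_) (fun v hv => ?_) hz hw
    · exact ((hloc v hv).differentiableAt_iff.2 (differentiableAt_const _)).differentiableWithinAt
    · rw [(hloc v hv).deriv_eq]; simp
  obtain ⟨M, hM⟩ := ((isCompact_sphere (0 : ℂ) r).image_of_continuousOn
    (continuousOn_sphere_of_differentiableOn hp hr hr')).isBounded.exists_norm_le
  obtain ⟨M', hM'⟩ := (isBounded_fociDist_le (y := y) (xl := xl) (xr := xr)
    ((xr - xl) / 2 * (r + r⁻¹))).exists_norm_le
  obtain ⟨z, hzD, hz, hfz⟩ := h1.exists_norm_sub_lt one_pos (max (M + 1) M')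
  have hzE : z ∉ E := fun h => absurd (hM' z h) (not_le.2 (lt_of_le_of_lt (le_max_right _ _) hz))
  have hfar : windingIntegral p r (f z) = 0 := by
    refine windingIntegral_eq_zero_of_norm_lt hp hr hr' fun ξ hξ => ?_
    have h3 := hM _ (mem_image_of_mem p hξ)
    have h4 := norm_sub_norm_le z (f z)
    rw [norm_sub_rev] at h4
    have h5 := le_max_left (M + 1) M'
    linarith
  rw [← hfar]
  exact hconst _ ⟨hJ hζ, not_le.2 ((lt_fociDist_joukowski_iff hx hr hζ.1).2 hrζ)⟩ _ ⟨hzD, hzE⟩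

/-- Near the slit, the imaginary part of `f` is close to the heights of the target slits. -/
theorem eventually_im_comp_joukowski_mem (hC : ∀ j, IsHorizontalSlit (C j))
    (hf : DifferentiableOn ℂ f (UHP \ ⋃ j, C j)) (hinj : InjOn f (UHP \ ⋃ j, C j))
    (h1 : SatisfiesH1 (UHP \ ⋃ j, C j) f) (hx : xl < xr) (hR₀ : 1 < R₀)
    (hJ : MapsTo (joukowski y xl xr) (unitAnnulus R₀) (UHP \ ⋃ j, C j))
    (hseg : ∀ z ∈ UHP \ ⋃ j, C j, xr - xl < fociDist y xl xr z)
    {G : Set ℂ} (hG : IsOpen G) (hsc : IsSimplyConnected G)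
    (hfG : MapsTo f (UHP \ ⋃ j, C j) G) {κ : Type*} {y' : κ → ℝ}
    (hGim : ∀ w ∈ G, w ∈ f '' (UHP \ ⋃ j, C j) ∨ ∃ k, w.im = y' k) {δ : ℝ} (hδ : 0 < δ) :
    ∃ r₁ > 1, ∀ ζ : ℂ, 1 < ‖ζ‖ → ‖ζ‖ < r₁ →
      (f (joukowski y xl xr ζ)).im ∈ ⋃ k, ball (y' k) δ := by
  set D := UHP \ ⋃ j, C j with hD
  set p := f ∘ joukowski y xl xr with hpdef
  have hp : DifferentiableOn ℂ p (unitAnnulus R₀) :=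
    hf.comp (differentiableOn_joukowski.mono fun ζ hζ => hζ.1) hJ
  have hpinj : InjOn p (unitAnnulus R₀) :=
    hinj.comp ((joukowski_injOn hx).mono fun ζ hζ => hζ.1) hJ
  obtain ⟨R, hR1, hR2⟩ := exists_between hR₀
  obtain ⟨hK, hKG⟩ := isCompact_closure_image_unitAnnulus hp hpinj hR1 hR2 hG hsc
    (hfG.comp hJ) fun r hr hr' ζ hζ hrζ =>
      windingIntegral_comp_joukowski_eq_zero hC hf hinj h1 hx hJ hr hr' hζ hrζ
  by_contra! hcon
  set l : Filter ℂ := comap norm (𝓝[>] 1) with hl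
  have hfreq : ∃ᶠ ζ in l, (p ζ).im ∉ ⋃ k, ball (y' k) δ := by
    intro hev
    rw [hl, Filter.eventually_comap, eventually_nhdsWithin_iff, Metric.eventually_nhds_iff] at hev
    obtain ⟨ε, hε, hev⟩ := hev
    obtain ⟨ζ, hζ1, hζ2, hζ3⟩ := hcon (1 + ε) (by linarith)
    refine hev (y := ‖ζ‖) ?_ hζ1 ζ rfl hζ3
    rw [Real.dist_eq, abs_of_pos (by linarith)]
    linarith
  have hnorm : Tendsto norm l (𝓝 (1 : ℝ)) := tendsto_comap.mono_right nhdsWithin_le_nhds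
  have hgt : ∀ᶠ ζ in l, 1 < ‖ζ‖ := tendsto_comap.eventually self_mem_nhdsWithin
  have hlt : ∀ r > 1, ∀ᶠ ζ in l, ‖ζ‖ < r := fun r hr => hnorm.eventually (gt_mem_nhds hr)
  have hmem : ∃ᶠ ζ in l, p ζ ∈ closure (p '' unitAnnulus R) ∩
      {w | w.im ∉ ⋃ k, ball (y' k) δ} := by
    refine (hfreq.and_eventually (hgt.and (hlt R hR1))).mono fun ζ h => ?_
    exact ⟨subset_closure ⟨ζ, ⟨h.2.1, h.2.2⟩, rfl⟩, h.1⟩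
  have hK' : IsCompact (closure (p '' unitAnnulus R) ∩ {w | w.im ∉ ⋃ k, ball (y' k) δ}) :=
    hK.inter_right (((isOpen_iUnion fun k => isOpen_ball).isClosed_compl).preimage continuous_im)
  obtain ⟨w, ⟨hwK, hwim⟩, hw⟩ := hK'.exists_mapClusterPt_of_frequently hmem
  rcases hGim w (hKG hwK) with ⟨z, hz, rfl⟩ | ⟨k, hk⟩
  · obtain ⟨c, hc1, hc2⟩ := exists_between (hseg z hz)
    have hN : D ∩ {v | c < fociDist y xl xr v} ∈ 𝓝 z :=
      inter_mem ((isOpen_UHP_diff_iUnion hC).mem_nhds hz)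
        ((isOpen_lt continuous_const continuous_fociDist).mem_nhds hc2)
    have hfz : 𝓝 (f z) ≤ map f (𝓝 z) := by
      have han : AnalyticAt ℂ f z :=
        hf.analyticAt ((isOpen_UHP_diff_iUnion hC).mem_nhds hz)
      refine han.eventually_constant_or_nhds_le_map_nhds.resolve_left fun hev => ?_
      have h2 : ∀ᶠ v in 𝓝[≠] z, False := by
        filter_upwards [hev.filter_mono nhdsWithin_le_nhds, nhdsWithin_le_nhds hN,
          self_mem_nhdsWithin] with v hv hvD hne
        exact hne (hinj hvD.1 hz hv)
      exact h2.exists.elim fun _ h => h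
    have hcl : ∃ᶠ ζ in l, p ζ ∈ f '' (D ∩ {v | c < fociDist y xl xr v}) :=
      mapClusterPt_iff_frequently.1 hw _ (hfz (image_mem_map hN))
    have hsmall : ∀ᶠ ζ in l, fociDist y xl xr (joukowski y xl xr ζ) < c := by
      have h3 : Tendsto (fun ζ : ℂ => (xr - xl) / 2 * (‖ζ‖ + ‖ζ‖⁻¹)) l
          (𝓝 ((xr - xl) / 2 * (1 + 1⁻¹))) :=
        (hnorm.add (hnorm.inv₀ one_ne_zero)).const_mul _
      filter_upwards [h3.eventually (gt_mem_nhds (show _ < c by norm_num; linarith)), hgt]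
        with ζ h4 h5
      rwa [fociDist_joukowski hx (norm_pos_iff.1 (by linarith))]
    obtain ⟨ζ, ⟨v, ⟨hvD, hvc⟩, hv⟩, h4, h5, h6⟩ :=
      (hcl.and_eventually (hsmall.and (hgt.and (hlt R₀ hR₀)))).exists
    have := hinj hvD (hJ ⟨h5, h6⟩) hv
    rw [this] at hvc
    exact lt_asymm hvc h4
  · exact hwim (mem_iUnion.2 ⟨k, by rw [hk]; exact mem_ball_self hδ⟩)

theorem isPreconnected_sphere_zero (r : ℝ) : IsPreconnected (sphere (0 : ℂ) r) :=
  isPreconnected_sphere (by simp [Complex.rank_real_complex]) 0 r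

/-- `Im (f z - z)` has the same limit `A` at all points of a slit, and is somewhere at most
`A`. -/
theorem exists_tendsto_im_sub_nhdsWithin (hC : ∀ j, IsHorizontalSlit (C j))
    (hf : DifferentiableOn ℂ f (UHP \ ⋃ j, C j)) (hinj : InjOn f (UHP \ ⋃ j, C j))
    (h1 : SatisfiesH1 (UHP \ ⋃ j, C j) f) (hx : xl < xr) (hR₀ : 1 < R₀)
    (hJ : MapsTo (joukowski y xl xr) (unitAnnulus R₀) (UHP \ ⋃ j, C j))
    (hseg : ∀ z ∈ UHP \ ⋃ j, C j, xr - xl < fociDist y xl xr z)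
    {G : Set ℂ} (hG : IsOpen G) (hsc : IsSimplyConnected G)
    (hfG : MapsTo f (UHP \ ⋃ j, C j) G) {κ : Type*} [Fintype κ] {y' : κ → ℝ}
    (hGim : ∀ w ∈ G, w ∈ f '' (UHP \ ⋃ j, C j) ∨ ∃ k, w.im = y' k) :
    ∃ A : ℝ, (∀ w : ℂ, fociDist y xl xr w ≤ xr - xl →
      Tendsto (fun z => (f z - z).im) (𝓝[UHP \ ⋃ j, C j] w) (𝓝 A)) ∧
      ∃ z ∈ UHP \ ⋃ j, C j, (f z - z).im ≤ A := by
  set D := UHP \ ⋃ j, C j with hD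
  set g : ℂ → ℂ := fun ζ => f (joukowski y xl xr ζ) - joukowski y xl xr ζ with hgdef
  have hJd : DifferentiableOn ℂ (joukowski y xl xr) (unitAnnulus R₀) :=
    differentiableOn_joukowski.mono fun ζ hζ => hζ.1
  have hg : DifferentiableOn ℂ g (unitAnnulus R₀) := (hf.comp hJd hJ).sub hJd
  obtain ⟨R, hR1, hR2⟩ := exists_between hR₀
  have hgc : ∀ r, 1 < r → r < R₀ → ContinuousOn g (sphere 0 r) := fun r hr hr' =>
    hg.continuousOn.mono (sphere_subset_unitAnnulus hr hr')
  have hgi : ∀ r, 1 < r → r < R₀ → CircleIntegrable (fun ζ => (g ζ).im) 0 r := fun r hr hr' =>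
    (continuous_im.comp_continuousOn (hgc r hr hr')).circleIntegrable (by linarith)
  set A := (Real.circleAverage g 0 R).im with hA
  have hav : ∀ r, 1 < r → r < R₀ → Real.circleAverage (fun ζ => (g ζ).im) 0 r = A := by
    intro r hr hr'
    rw [hA, circleAverage_eq_of_differentiableOn_unitAnnulus hg hR1 hR2 hr hr']
    exact Complex.imCLM.circleAverage_comp_comm ((hgc r hr hr').circleIntegrable (by linarith))
  have hclose : ∀ ε > 0, ∃ r₁ > 1, ∀ ζ : ℂ, 1 < ‖ζ‖ → ‖ζ‖ < r₁ → |(g ζ).im - A| ≤ ε := by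
    intro ε hε
    set δ := ε / (4 * (Fintype.card κ + 1)) with hδ
    have hδ0 : 0 < δ := by positivity
    obtain ⟨r₁, hr₁, him⟩ := eventually_im_comp_joukowski_mem hC hf hinj h1 hx hR₀ hJ hseg hG hsc
      hfG hGim hδ0
    have ht : Tendsto (fun r : ℝ => (xr - xl) / 4 * (r - r⁻¹)) (𝓝[>] 1) (𝓝 0) := by
      have : Tendsto (fun r : ℝ => (xr - xl) / 4 * (r - r⁻¹)) (𝓝 1)
          (𝓝 ((xr - xl) / 4 * (1 - 1⁻¹))) := by
        apply ContinuousAt.tendsto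
        fun_prop (disch := norm_num)
      simpa using this.mono_left nhdsWithin_le_nhds
    obtain ⟨r₂, hr₂, hr₂1⟩ : ∃ r₂ > 1, ∀ r, 1 < r → r < r₂ →
        (xr - xl) / 4 * (r - r⁻¹) < ε / 4 := by
      obtain ⟨u, hu, hu'⟩ := mem_nhdsGT_iff_exists_Ioo_subset.1
        (ht.eventually (gt_mem_nhds (show 0 < ε / 4 by linarith)))
      exact ⟨u, hu, fun r hr hr' => hu' ⟨hr, hr'⟩⟩
    refine ⟨min R₀ (min r₁ r₂), lt_min hR₀ (lt_min hr₁ hr₂), fun ζ hζ1 hζ2 => ?_⟩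
    set r := ‖ζ‖ with hr
    obtain ⟨hrR, hr1, hr2⟩ : r < R₀ ∧ r < r₁ ∧ r < r₂ := by
      simpa [lt_min_iff] using hζ2
    have hosc : ∀ ξ ∈ sphere (0 : ℂ) r, |(g ζ).im - (g ξ).im| ≤ ε := by
      intro ξ hξ
      have hξr : ‖ξ‖ = r := by simpa using hξ
      have hS : IsPreconnected ((fun η => (f (joukowski y xl xr η)).im) '' sphere 0 r) := by
        refine (isPreconnected_sphere_zero r).image _ (continuous_im.comp_continuousOn ?_)
        exact (hf.comp hJd hJ).continuousOn.mono (sphere_subset_unitAnnulus hζ1 hrR)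
      have hSc : (fun η => (f (joukowski y xl xr η)).im) '' sphere 0 r ⊆ ⋃ k, ball (y' k) δ := by
        rintro _ ⟨η, hη, rfl⟩
        have hηr : ‖η‖ = r := by simpa using hη
        exact him η (by rw [hηr]; exact hζ1) (by rw [hηr]; exact hr1)
      have h2 := abs_sub_le_of_isPreconnected_of_subset_iUnion_ball hS hSc
        (mem_image_of_mem _ (show ζ ∈ sphere (0 : ℂ) r by simp [hr])) (mem_image_of_mem _ hξ)
      have h3 := abs_joukowski_im_sub_le (y := y) hx hζ1
      have h4 := abs_joukowski_im_sub_le (y := y) hx (ζ := ξ) (by rw [hξr]; exact hζ1)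
      have h5 := hr₂1 r hζ1 hr2
      rw [hξr] at h4
      have h6 : Fintype.card κ * (2 * δ) ≤ ε / 2 := by
        rw [hδ]
        have : (0 : ℝ) < Fintype.card κ + 1 := by positivity
        rw [← sub_nonneg]
        have e : ε / 2 - Fintype.card κ * (2 * (ε / (4 * (Fintype.card κ + 1)))) =
            ε / (2 * (Fintype.card κ + 1)) := by field_simp; ring
        rw [e]; positivity
      simp only [hgdef, Complex.sub_im]
      rw [abs_le] at *
      constructor <;> linarith [h2.1, h2.2, h3.1, h3.2, h4.1, h4.2]
    have hlow : (g ζ).im - ε ≤ A := by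
      have h2 := Real.circleAverage_mono (f₁ := fun _ => (g ζ).im - ε)
        (circleIntegrable_const _ 0 r) (hgi r hζ1 hrR) (fun ξ hξ => by
          rw [abs_of_pos (by linarith)] at hξ
          have := (abs_le.1 (hosc ξ hξ)).2
          linarith)
      rwa [Real.circleAverage_const, hav r hζ1 hrR] at h2
    have hup : A ≤ (g ζ).im + ε := by
      have h2 := Real.circleAverage_mono_on_of_le_circle (a := (g ζ).im + ε)
        (hgi r hζ1 hrR) (fun ξ hξ => by
          rw [abs_of_pos (by linarith)] at hξ
          have := (abs_le.1 (hosc ξ hξ)).1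
          linarith)
      rwa [hav r hζ1 hrR] at h2
    rw [abs_le]; constructor <;> linarith
  refine ⟨A, fun w hw => ?_, ?_⟩
  · rw [Metric.tendsto_nhds]
    intro ε hε
    obtain ⟨r₁, hr₁, hcl⟩ := hclose (ε / 2) (by linarith)
    have hlev : fociDist y xl xr w < (xr - xl) / 2 * (r₁ + r₁⁻¹) := by
      have := strictMono_add_inv le_rfl hr₁
      norm_num at this
      nlinarith
    filter_upwards [self_mem_nhdsWithin, nhdsWithin_le_nhds
      (continuous_fociDist.continuousAt.eventually (gt_mem_nhds hlev))] with z hz hz2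
    obtain ⟨ζ, hζ, rfl⟩ := exists_joukowski_eq hx (hseg z hz)
    rw [fociDist_joukowski hx (norm_pos_iff.1 (by linarith)),
      mul_lt_mul_iff_of_pos_left (by linarith)] at hz2
    have hζr : ‖ζ‖ < r₁ := by
      by_contra! hle
      rcases hle.lt_or_eq with h3 | h3
      · exact absurd (strictMono_add_inv hr₁.le h3) (by linarith)
      · rw [h3] at hz2; exact lt_irrefl _ hz2
    rw [Real.dist_eq]
    exact lt_of_le_of_lt (hcl ζ hζ hζr) (by linarith)
  · by_contra! hcon
    obtain ⟨ξ, hξ, hmin⟩ := (isCompact_sphere (0 : ℂ) R).exists_isMinOn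
      (NormedSpace.sphere_nonempty.2 (by linarith))
      (continuous_im.comp_continuousOn (hgc R hR1 hR2))
    have h2 := Real.circleAverage_mono (f₁ := fun _ => (g ξ).im)
      (circleIntegrable_const _ 0 R) (hgi R hR1 hR2) (fun η hη => by
        rw [abs_of_pos (by linarith)] at hη
        exact hmin hη)
    rw [Real.circleAverage_const, hav R hR1 hR2] at h2
    exact absurd (hcon _ (hJ (sphere_subset_unitAnnulus hR1 hR2 hξ))) (not_lt.2 h2)

/-- The boundary behaviour of `Im (f z - z)` at the `j`-th slit of a parallel slit half-plane. -/
theorem exists_tendsto_im_sub_of_mem_slit (hC : ∀ j, IsHorizontalSlit (C j))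
    (hdisj : Pairwise fun i j => Disjoint (C i) (C j))
    (hf : DifferentiableOn ℂ f (UHP \ ⋃ j, C j)) (hinj : InjOn f (UHP \ ⋃ j, C j))
    (h1 : SatisfiesH1 (UHP \ ⋃ j, C j) f) {G : Set ℂ} (hG : IsOpen G)
    (hsc : IsSimplyConnected G) (hfG : MapsTo f (UHP \ ⋃ j, C j) G) {κ : Type*} [Fintype κ]
    {y' : κ → ℝ} (hGim : ∀ w ∈ G, w ∈ f '' (UHP \ ⋃ j, C j) ∨ ∃ k, w.im = y' k) (j : ι) :
    ∃ A : ℝ, (∀ w ∈ C j, Tendsto (fun z => (f z - z).im) (𝓝[UHP \ ⋃ j, C j] w) (𝓝 A)) ∧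
      ∃ z ∈ UHP \ ⋃ j, C j, (f z - z).im ≤ A := by
  obtain ⟨y, xl, xr, hy, hx, hCj⟩ := hC j
  have hCj' : ∀ z, z ∈ C j ↔ fociDist y xl xr z ≤ xr - xl := fun z => by
    rw [← mem_segment_iff_fociDist, hCj]; rfl
  have hO : IsOpen (UHP \ ⋃ k : {k // k ≠ j}, C k) := isOpen_UHP_diff_iUnion fun k => hC k
  obtain ⟨R₀, hR₀, hsub⟩ := exists_fociDist_lt_subset (y := y) (xl := xl) (xr := xr) hO
    fun z hz => by
      have hzj := (hCj' z).2 hz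
      refine ⟨?_, fun hmem => ?_⟩
      · rw [hCj] at hzj
        exact lt_of_lt_of_eq hy hzj.1.symm
      · obtain ⟨⟨k, hk⟩, hzk⟩ := mem_iUnion.1 hmem
        exact disjoint_left.1 (hdisj hk) hzk hzj
  have hJ : MapsTo (joukowski y xl xr) (unitAnnulus R₀) (UHP \ ⋃ j, C j) := by
    intro ζ hζ
    have hO' : joukowski y xl xr ζ ∈ UHP \ ⋃ k : {k // k ≠ j}, C k := by
      apply hsub
      rw [mem_ofPred_eq, fociDist_joukowski hx (norm_pos_iff.1 (by linarith [hζ.1])),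
        mul_lt_mul_iff_of_pos_left (by linarith)]
      exact strictMono_add_inv hζ.1.le hζ.2
    refine ⟨hO'.1, fun hmem => ?_⟩
    obtain ⟨k, hk⟩ := mem_iUnion.1 hmem
    by_cases hkj : k = j
    · subst hkj
      exact absurd ((hCj' _).1 hk) (not_le.2 (xr_sub_xl_lt_fociDist_joukowski hx hζ.1))
    · exact hO'.2 (mem_iUnion.2 ⟨⟨k, hkj⟩, hk⟩)
  have hseg : ∀ z ∈ UHP \ ⋃ j, C j, xr - xl < fociDist y xl xr z := by
    intro z hz
    by_contra! hle
    exact hz.2 (mem_iUnion.2 ⟨j, (hCj' z).2 hle⟩)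
  obtain ⟨A, hA, hA'⟩ :=
    exists_tendsto_im_sub_nhdsWithin hC hf hinj h1 hx hR₀ hJ hseg hG hsc hfG hGim
  exact ⟨A, fun w hw => hA w ((hCj' w).1 hw), hA'⟩

end SlitBoundary

section Positivity

/-- A Phragmén–Lindelöf estimate: the imaginary part of `f z - z` is bounded below by a multiple
of the Poisson kernel at infinity. -/
theorem neg_le_im_sub_of_satisfiesH1 {D : Set ℂ} {f : ℂ → ℂ} (hD : IsOpen D)
    (hf : DifferentiableOn ℂ f D) (h1 : SatisfiesH1 D f) (hpos : ∀ z ∈ D, 0 < (f z).im) {R : ℝ}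
    (hR : 0 < R) (hRD : ∀ z : ℂ, 0 < z.im → R ≤ ‖z‖ → z ∈ D) {z : ℂ} (hz : 0 < z.im)
    (hRz : R ≤ ‖z‖) : -(R ^ 2 * (z.im / ‖z‖ ^ 2)) ≤ (f z - z).im := by
  have hlow : ∀ w ∈ D, -w.im ≤ (f w - w).im := fun w hw => by
    rw [Complex.sub_im]; linarith [hpos w hw]
  rcases hRz.eq_or_lt with heq | hlt
  · have : R ^ 2 * (z.im / ‖z‖ ^ 2) = z.im := by
      rw [← heq]; field_simp
    rw [this]
    exact hlow z (hRD z hz hRz)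
  obtain ⟨η, hη, hηD, ht⟩ := h1
  obtain ⟨B, hB⟩ : ∃ B : ℝ, ∀ w : ℂ, B < ‖w‖ → η < w.im → -1 ≤ (f w - w).im := by
    have h2 := ht.eventually (Metric.ball_mem_nhds (0 : ℂ) one_pos)
    rw [eventually_inf_principal, ← comap_norm_atTop, eventually_comap] at h2
    obtain ⟨B, hB⟩ := eventually_atTop.1 h2
    refine ⟨B, fun w hw hwη => ?_⟩
    have h3 : ‖f w - w‖ < 1 := by simpa using hB ‖w‖ hw.le w rfl hwη
    have h4 := neg_abs_le (f w - w).im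
    have h5 := Complex.abs_im_le_norm (f w - w)
    linarith
  have hL : 0 < Real.log ‖z‖ - Real.log R := sub_pos.2 (Real.log_lt_log hR hlt)
  have key : ∀ ε > 0, ∀ δ > 0, δ < z.im →
      -δ ≤ (f z - z).im + R ^ 2 * (z.im / ‖z‖ ^ 2) + ε * (Real.log ‖z‖ - Real.log R) := by
    intro ε hε δ hδ hδz
    obtain ⟨R', hR'⟩ := exists_gt (max ‖z‖ (max B (R * Real.exp ((η + 1) / ε))))
    obtain ⟨hR1, hR2, hR3⟩ : ‖z‖ < R' ∧ B < R' ∧ R * Real.exp ((η + 1) / ε) < R' := by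
      simpa [max_lt_iff] using hR'
    set U : Set ℂ := {w | δ < w.im} ∩ {w | R < ‖w‖} ∩ {w | ‖w‖ < R'} with hU
    have hUo : IsOpen U := ((isOpen_lt continuous_const continuous_im).inter
      (isOpen_lt continuous_const continuous_norm)).inter
      (isOpen_lt continuous_norm continuous_const)
    have hUb : IsBounded U := (isBounded_ball (x := (0 : ℂ)) (r := R')).subset fun w hw => by
      simpa using hw.2
    have hUcl : closure U ⊆ {w | δ ≤ w.im} ∩ {w | R ≤ ‖w‖} ∩ {w | ‖w‖ ≤ R'} := by
      refine closure_minimal ?_ ?_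
      · rintro w ⟨⟨ha, hb⟩, hc⟩
        simp only [mem_ofPred_eq] at ha hb hc
        exact ⟨⟨ha.le, hb.le⟩, by simpa using hc.le⟩
      exact ((isClosed_le continuous_const continuous_im).inter
        (isClosed_le continuous_const continuous_norm)).inter
        (isClosed_le continuous_norm continuous_const)
    set F : ℂ → ℂ := fun w => Complex.exp (I * (f w - w - (R ^ 2 : ℝ) / w) -
      ε * (Complex.log w - Real.log R)) with hF
    have hFn : ∀ w, ‖F w‖ = Real.exp (-((f w - w).im + R ^ 2 * (w.im / ‖w‖ ^ 2) +
        ε * (Real.log ‖w‖ - Real.log R))) := by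
      intro w
      rw [hF, Complex.norm_exp]
      congr 1
      rw [Complex.sub_re, Complex.re_ofReal_mul, Complex.sub_re, Complex.log_re, Complex.ofReal_re,
        Complex.I_mul_re, Complex.sub_im, div_eq_mul_inv, Complex.im_ofReal_mul, Complex.inv_im,
        Complex.normSq_eq_norm_sq]
      ring
    have hd : DiffContOnCl ℂ F U := by
      apply DifferentiableOn.diffContOnCl
      intro w hw
      have hw' := hUcl hw
      have hwim : 0 < w.im := lt_of_lt_of_le hδ hw'.1.1
      have hfw : DifferentiableAt ℂ f w :=
        hf.differentiableAt (hD.mem_nhds (hRD w hwim hw'.1.2))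
      have hw0 : w ≠ 0 := norm_pos_iff.1 (lt_of_lt_of_le hR hw'.1.2)
      have hlog : DifferentiableAt ℂ Complex.log w :=
        (Complex.hasDerivAt_log (Or.inr hwim.ne')).differentiableAt
      have hinv : DifferentiableAt ℂ (fun w : ℂ => ((R ^ 2 : ℝ) : ℂ) / w) w :=
        (differentiableAt_const _).div differentiableAt_id hw0
      exact ((((hfw.sub differentiableAt_id).sub hinv).const_mul I).sub
        ((hlog.sub_const _).const_mul _)).cexp.differentiableWithinAt
    have hfr : ∀ w ∈ frontier U, ‖F w‖ ≤ Real.exp δ := by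
      intro w hw
      rw [hUo.frontier_eq] at hw
      obtain ⟨⟨ha, hb⟩, hc⟩ := hUcl hw.1
      have ha : δ ≤ w.im := ha
      have hb : R ≤ ‖w‖ := hb
      have hc : ‖w‖ ≤ R' := hc
      have hwim : 0 < w.im := by linarith
      have hwD := hRD w hwim hb
      have hw1 := hlow w hwD
      have hlog : 0 ≤ ε * (Real.log ‖w‖ - Real.log R) :=
        mul_nonneg hε.le (sub_nonneg.2 (Real.log_le_log hR hb))
      have hM : 0 ≤ R ^ 2 * (w.im / ‖w‖ ^ 2) := by positivity
      rw [hFn, Real.exp_le_exp]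
      rcases ha.eq_or_lt with ha' | ha'
      · linarith
      rcases hb.eq_or_lt with hb' | hb'
      · have : R ^ 2 * (w.im / ‖w‖ ^ 2) = w.im := by rw [← hb']; field_simp
        linarith
      rcases hc.eq_or_lt with hc' | hc'
      · have h3 : -(η + 1) ≤ (f w - w).im := by
          rcases lt_or_ge η w.im with h4 | h4
          · linarith [hB w (by linarith) h4]
          · linarith
        have h5 : η + 1 ≤ ε * (Real.log ‖w‖ - Real.log R) := by
          have h6 := Real.log_lt_log (by positivity) hR3
          rw [Real.log_mul hR.ne' (Real.exp_ne_zero _), Real.log_exp] at h6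
          rw [hc', mul_comm, ← div_le_iff₀ hε]
          linarith
        linarith
      · exact absurd ⟨⟨ha', hb'⟩, hc'⟩ hw.2
    have := Complex.norm_le_of_forall_mem_frontier_norm_le hUb hd hfr
      (subset_closure (show z ∈ U from ⟨⟨hδz, hlt⟩, hR1⟩))
    rw [hFn, Real.exp_le_exp] at this
    linarith
  by_contra! hneg
  set S := (f z - z).im + R ^ 2 * (z.im / ‖z‖ ^ 2) with hS
  have hS0 : S < 0 := by linarith
  have h2 := key (-S / (3 * (Real.log ‖z‖ - Real.log R))) (div_pos (by linarith) (by linarith))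
    (min (z.im / 2) (-S / 3)) (lt_min (by linarith) (by linarith))
    (lt_of_le_of_lt (min_le_left _ _) (by linarith))
  have h3 : -S / (3 * (Real.log ‖z‖ - Real.log R)) * (Real.log ‖z‖ - Real.log R) = -S / 3 := by
    field_simp
  have h4 := min_le_right (z.im / 2) (-S / 3)
  rw [h3] at h2
  linarith

/-- The minimum principle for `Im (f z - z)`. -/
theorem im_sub_nonneg_of_isSimplyConnected {ι : Type*} [Finite ι] {C : ι → Set ℂ} {f : ℂ → ℂ}
    (hC : ∀ j, IsHorizontalSlit (C j)) (hdisj : Pairwise fun i j => Disjoint (C i) (C j))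
    (hf : DifferentiableOn ℂ f (UHP \ ⋃ j, C j)) (hinj : InjOn f (UHP \ ⋃ j, C j))
    (h1 : SatisfiesH1 (UHP \ ⋃ j, C j) f) (hpos : ∀ z ∈ UHP \ ⋃ j, C j, 0 < (f z).im)
    {G : Set ℂ} (hG : IsOpen G) (hsc : IsSimplyConnected G)
    (hfG : MapsTo f (UHP \ ⋃ j, C j) G) {κ : Type*} [Fintype κ]
    {y' : κ → ℝ} (hGim : ∀ w ∈ G, w ∈ f '' (UHP \ ⋃ j, C j) ∨ ∃ k, w.im = y' k) {z : ℂ}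
    (hz : z ∈ UHP \ ⋃ j, C j) : 0 ≤ (f z - z).im := by
  have hDo := isOpen_UHP_diff_iUnion hC
  have hDpre : IsPreconnected (UHP \ ⋃ j, C j) := by
    simpa using isPreconnected_UHP_diff hC convex_empty isBounded_empty (by simpa using hDo)
  have hslit := exists_tendsto_im_sub_of_mem_slit hC hdisj hf hinj h1 hG hsc hfG hGim
  have hCb : ∃ R > 0, ∀ w ∈ ⋃ j, C j, ‖w‖ < R := by
    obtain ⟨R, hR⟩ := (isBounded_iUnion_of_isHorizontalSlit hC).exists_norm_le
    exact ⟨|R| + 1, by positivity, fun w hw => by linarith [hR w hw, le_abs_self R]⟩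
  set D := UHP \ ⋃ j, C j with hD
  have hlow : ∀ w ∈ D, -w.im ≤ (f w - w).im := fun w hw => by
    rw [Complex.sub_im]; linarith [hpos w hw]
  by_contra! hneg
  set m := (f z - z).im with hm
  obtain ⟨R, hR, hCR⟩ := hCb
  have hpl : ∀ w : ℂ, 0 < w.im → R ≤ ‖w‖ → -(R ^ 2 / ‖w‖) ≤ (f w - w).im := by
    intro w hw hRw
    refine le_trans ?_ (neg_le_im_sub_of_satisfiesH1 hDo hf h1 hpos hR
      (fun v hv hRv => ⟨hv, fun hmem => absurd (hCR v hmem) (not_lt.2 hRv)⟩) hw hRw)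
    have h0 : 0 < ‖w‖ := by linarith
    have h2 : w.im / ‖w‖ ^ 2 ≤ ‖w‖⁻¹ := by
      rw [div_le_iff₀ (by positivity)]
      field_simp
      exact (le_abs_self _).trans (Complex.abs_im_le_norm w)
    rw [neg_le_neg_iff, div_eq_mul_inv]
    exact mul_le_mul_of_nonneg_left h2 (sq_nonneg R)
  set B := max R (R ^ 2 / (-m)) with hB
  set S := {w ∈ D | (f w - w).im ≤ m} with hSdef
  have hSK : S ⊆ closedBall 0 B ∩ {w | -m ≤ w.im} := by
    rintro w ⟨hwD, hw⟩
    have h2 := hlow w hwD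
    refine ⟨?_, ?_⟩
    · rw [mem_closedBall_zero_iff]
      by_contra! hlt
      obtain ⟨h3, h4⟩ := max_lt_iff.1 hlt
      have h5 := hpl w hwD.1 h3.le
      have h6 : R ^ 2 / ‖w‖ < -m := by
        rw [div_lt_iff₀ (by linarith)]
        rw [div_lt_iff₀ (by linarith)] at h4
        linarith
      linarith
    · rw [mem_ofPred_eq]; linarith
  have hKc : IsCompact (closedBall (0 : ℂ) B ∩ {w | -m ≤ w.im}) :=
    (isCompact_closedBall _ _).inter_right (isClosed_le continuous_const continuous_im)
  have hSb : BddBelow ((fun w => (f w - w).im) '' S) := by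
    refine ⟨-B, ?_⟩
    rintro _ ⟨w, hw, rfl⟩
    have h2 : ‖w‖ ≤ B := by simpa using (hSK hw).1
    have h3 := hlow w hw.1
    have h4 := Complex.abs_im_le_norm w
    have h5 := le_abs_self w.im
    change -B ≤ (f w - w).im
    linarith
  have hzS : z ∈ S := ⟨hz, le_rfl⟩
  obtain ⟨u, -, hu, huS⟩ := exists_seq_tendsto_sInf
    (⟨_, mem_image_of_mem _ hzS⟩ : ((fun w => (f w - w).im) '' S).Nonempty) hSb
  choose v hvS hv using huS
  obtain ⟨w, hwK, ψ, hψ, hw⟩ := hKc.tendsto_subseq fun n => hSK (hvS n)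
  set μ := sInf ((fun w => (f w - w).im) '' S) with hμ
  have hμS : ∀ w ∈ S, μ ≤ (f w - w).im := fun w hw => csInf_le hSb (mem_image_of_mem _ hw)
  have hlim : Tendsto (fun n => (f (v (ψ n)) - v (ψ n)).im) atTop (𝓝 μ) := by
    simpa only [Function.comp_def, ← hv] using hu.comp hψ.tendsto_atTop
  have hwD : Tendsto (v ∘ ψ) atTop (𝓝[D] w) :=
    tendsto_nhdsWithin_iff.2 ⟨hw, Eventually.of_forall fun n => (hvS (ψ n)).1⟩
  obtain ⟨x, hxD, hx⟩ : ∃ x ∈ D, (f x - x).im ≤ μ := by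
    by_cases hwmem : w ∈ ⋃ j, C j
    · obtain ⟨j, hj⟩ := mem_iUnion.1 hwmem
      obtain ⟨A, hA, hA'⟩ := hslit j
      rwa [tendsto_nhds_unique ((hA w hj).comp hwD) hlim] at hA'
    · have hwim : -m ≤ w.im := hwK.2
      have hwD' : w ∈ D := ⟨by change 0 < w.im; linarith, hwmem⟩
      refine ⟨w, hwD', le_of_eq (tendsto_nhds_unique ?_ hlim)⟩
      have hc : ContinuousWithinAt (fun w => (f w - w).im) D w :=
        (continuous_im.continuousAt.comp_continuousWithinAt
          ((hf.continuousOn w hwD').sub continuousWithinAt_id))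
      exact hc.tendsto.comp hwD
  have hμm : μ ≤ m := hμS z hzS
  have hmin : ∀ w ∈ D, (f x - x).im ≤ (f w - w).im := by
    intro w hw
    rcases le_or_gt (f w - w).im m with h2 | h2
    · exact hx.trans (hμS w ⟨hw, h2⟩)
    · linarith
  have hnorm : ∀ w, ‖Complex.exp (I * (f w - w))‖ = Real.exp (-(f w - w).im) := by
    intro w
    rw [Complex.norm_exp, Complex.I_mul_re]
  have hconst := Complex.norm_eqOn_of_isPreconnected_of_isMaxOn
    (f := fun w => Complex.exp (I * (f w - w))) hDpre hDo
    (((hf.sub differentiableOn_id).const_mul I).cexp) hxD (fun w hw => by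
      simp only [Function.comp, mem_ofPred_eq, hnorm]
      exact Real.exp_le_exp.2 (neg_le_neg (hmin w hw)))
  obtain ⟨w, hw, -, hfw⟩ := h1.exists_norm_sub_lt (show 0 < -m by linarith) 0
  have h2 := hconst hw
  simp only [Function.comp, Function.const, hnorm, Real.exp_eq_exp] at h2
  have h3 := neg_abs_le (f w - w).im
  have h4 := Complex.abs_im_le_norm (f w - w)
  linarith

end Positivity

section Residue

/-- An angular residue is real and nonnegative as soon as `Im (f z - z) ≥ 0` near infinity. -/
theorem SatisfiesH2.im_eq_zero_and_re_nonneg {f : ℂ → ℂ} {c : ℂ} (h2 : SatisfiesH2 f c) {R : ℝ}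
    (hpos : ∀ z : ℂ, 0 < z.im → R ≤ ‖z‖ → 0 ≤ (f z - z).im) : c.im = 0 ∧ 0 ≤ c.re := by
  have key : ∀ α ∈ Ioo 0 Real.pi, 0 ≤ Real.sin α * c.re - Real.cos α * c.im := by
    intro α hα
    set e : ℂ := Complex.cos α + Complex.sin α * I with he
    have hsin : 0 < Real.sin α := Real.sin_pos_of_pos_of_lt_pi hα.1 hα.2
    have hre : e.re = Real.cos α := by
      simp [he, ← Complex.ofReal_cos, ← Complex.ofReal_sin]
    have him : e.im = Real.sin α := by
      simp [he, ← Complex.ofReal_cos, ← Complex.ofReal_sin]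
    have hen : ‖e‖ = 1 := by
      rw [he, ← Complex.exp_mul_I, Complex.norm_exp_ofReal_mul_I]
    obtain ⟨θ, hθ, hθ'⟩ := exists_between (lt_min hα.1 (sub_pos.2 hα.2))
    rw [lt_min_iff] at hθ'
    have hray : Tendsto (fun r : ℝ => (r : ℂ) * e) atTop (cobounded ℂ ⊓ 𝓟 (Sector θ)) := by
      refine tendsto_inf.2 ⟨?_, tendsto_principal.2 ?_⟩
      · rw [← tendsto_norm_atTop_iff_cobounded]
        simpa [hen] using tendsto_abs_atTop_atTop
      · filter_upwards [eventually_gt_atTop 0] with r hr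
        have harg : Complex.arg ((r : ℂ) * e) = α :=
          Complex.arg_mul_cos_add_sin_mul_I hr ⟨by linarith [hα.1, Real.pi_pos], hα.2.le⟩
        exact ⟨by rw [harg]; exact hθ'.1, by rw [harg]; linarith [hθ'.2]⟩
    have hlim := ((h2 θ hθ (by linarith [hθ'.1, hθ'.2])).comp hray).const_mul
      (starRingEnd ℂ e)
    have hlim' := (continuous_im.tendsto _).comp hlim
    have hval : (starRingEnd ℂ e * -c).im = Real.sin α * c.re - Real.cos α * c.im := by
      rw [Complex.mul_im, Complex.conj_re, Complex.conj_im, hre, him, Complex.neg_re,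
        Complex.neg_im]
      ring
    rw [← hval]
    refine ge_of_tendsto hlim' ?_
    filter_upwards [eventually_gt_atTop 0, eventually_ge_atTop R] with r hr hrR
    have h3 : starRingEnd ℂ e * ((r : ℂ) * e * (f (r * e) - r * e)) =
        (r : ℝ) * (f (r * e) - r * e) := by
      have : starRingEnd ℂ e * e = 1 := by
        rw [mul_comm, Complex.mul_conj, Complex.normSq_eq_norm_sq, hen]; simp
      linear_combination (r : ℂ) * (f (r * e) - r * e) * this
    simp only [Function.comp_apply]
    rw [h3, Complex.im_ofReal_mul]
    refine mul_nonneg hr.le (hpos _ ?_ ?_)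
    · rw [Complex.im_ofReal_mul, him]; positivity
    · rw [norm_mul, hen, mul_one, Complex.norm_of_nonneg hr.le]; exact hrR
  have hclosed : IsClosed {α : ℝ | 0 ≤ Real.sin α * c.re - Real.cos α * c.im} :=
    isClosed_le continuous_const (by fun_prop)
  have hIcc : Icc 0 Real.pi ⊆ {α : ℝ | 0 ≤ Real.sin α * c.re - Real.cos α * c.im} := by
    rw [← closure_Ioo Real.pi_pos.ne]
    exact closure_minimal key hclosed
  have a0 := hIcc (left_mem_Icc.2 Real.pi_pos.le)
  have a1 := hIcc (right_mem_Icc.2 Real.pi_pos.le)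
  have a2 := hIcc ⟨by linarith [Real.pi_pos], by linarith [Real.pi_pos]⟩ (a := Real.pi / 2)
  simp at a0 a1 a2
  exact ⟨le_antisymm a0 a1, a2⟩

/-- The angular residue of a hydrodynamically normalised univalent map between parallel slit
half-planes that omits only an `ℍ`-hull is real and nonnegative. -/
theorem SatisfiesH2.im_eq_zero_and_re_nonneg_of_isHHull {D₁ D₂ : Set ℂ} {f : ℂ → ℂ} {c : ℂ}
    (h2 : SatisfiesH2 f c) (hD₁ : IsParallelSlitHalfPlane D₁) (hD₂ : IsParallelSlitHalfPlane D₂)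
    (hmaps : MapsTo f D₁ D₂) (hf : DifferentiableOn ℂ f D₁) (hinj : InjOn f D₁)
    (h1 : SatisfiesH1 D₁ f) (h3 : IsHHull (D₂ \ f '' D₁)) : c.im = 0 ∧ 0 ≤ c.re := by
  obtain ⟨N, C, hC, hdisj, rfl⟩ := hD₁
  obtain ⟨N', C', hC', -, rfl⟩ := hD₂
  set D := UHP \ ⋃ j, C j with hD
  set F := (UHP \ ⋃ k, C' k) \ f '' D with hF
  obtain ⟨hFU, hFcl, -, hsc⟩ := h3
  have hG : IsOpen (UHP \ F) := by
    have : UHP \ F = UHP \ closure F := by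
      refine Subset.antisymm (fun z hz => ⟨hz.1, fun h => hz.2 (hFcl ⟨h, hz.1⟩)⟩)
        (sdiff_subset_sdiff_right subset_closure)
    rw [this]
    exact isOpen_UHP.sdiff isClosed_closure
  choose y' xl xr hy hx hCe using hC'
  have hfG : MapsTo f D (UHP \ F) := fun z hz =>
    ⟨(hmaps hz).1, fun h => h.2 (mem_image_of_mem f hz)⟩
  have hGim : ∀ w ∈ UHP \ F, w ∈ f '' D ∨ ∃ k, w.im = y' k := by
    rintro w ⟨hw, hwF⟩
    by_cases hwD : w ∈ f '' D
    · exact Or.inl hwD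
    · right
      by_contra! hne
      refine hwF ⟨⟨hw, fun hmem => ?_⟩, hwD⟩
      obtain ⟨k, hk⟩ := mem_iUnion.1 hmem
      rw [hCe k] at hk
      exact hne k hk.1
  obtain ⟨R, hR⟩ := (isBounded_iUnion_of_isHorizontalSlit hC).exists_norm_le
  refine h2.im_eq_zero_and_re_nonneg (R := R + 1) fun z hz hRz => ?_
  exact im_sub_nonneg_of_isSimplyConnected hC hdisj hf hinj h1 (fun w hw => (hmaps hw).1) hG hsc
    hfG hGim ⟨hz, fun hmem => absurd (hR z hmem) (by linarith)⟩

/-- Angular residues are additive under composition. -/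
theorem SatisfiesH2.residue_comp {D : Set ℂ} {f g k : ℂ → ℂ} {a b c : ℂ} (h1 : SatisfiesH1 D g)
    (hg : SatisfiesH2 g a) (hf : SatisfiesH2 f b) (hk : SatisfiesH2 k c)
    (hkfg : ∀ z ∈ D, k z = f (g z)) : c = a + b := by
  obtain ⟨η, hη, hηD, ht⟩ := h1
  have hπ := Real.pi_pos
  have hπ4 : 0 < Real.pi / 4 := by positivity
  have hπ4' : Real.pi / 4 < Real.pi / 2 := by linarith
  set z : ℝ → ℂ := fun Y => (Y : ℂ) * I with hz
  have hzc : Tendsto z atTop (cobounded ℂ) := by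
    rw [← tendsto_norm_atTop_iff_cobounded]
    simpa [hz] using tendsto_abs_atTop_atTop
  have hzD : ∀ᶠ Y in atTop, z Y ∈ HP η := by
    filter_upwards [eventually_gt_atTop η] with Y hY
    simpa [HP, hz] using hY
  have hzS : Tendsto z atTop (cobounded ℂ ⊓ 𝓟 (Sector (Real.pi / 4))) := by
    refine tendsto_inf.2 ⟨hzc, tendsto_principal.2 ?_⟩
    filter_upwards [eventually_gt_atTop 0] with Y hY
    have : Complex.arg (z Y) = Real.pi / 2 := by
      rw [hz, Complex.arg_real_mul _ hY, Complex.arg_I]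
    exact ⟨by rw [this]; linarith, by rw [this]; linarith⟩
  have hdiff : Tendsto (fun Y => g (z Y) - z Y) atTop (𝓝 0) :=
    ht.comp (tendsto_inf.2 ⟨hzc, tendsto_principal.2 hzD⟩)
  have hratio : Tendsto (fun Y => g (z Y) / z Y) atTop (𝓝 1) := by
    have h3 : Tendsto (fun Y => 1 + (g (z Y) - z Y) * (z Y)⁻¹) atTop (𝓝 (1 + 0 * 0)) :=
      (hdiff.mul (tendsto_inv₀_cobounded.comp hzc)).const_add 1
    rw [zero_mul, add_zero] at h3
    refine h3.congr' ?_
    filter_upwards [eventually_gt_atTop 0] with Y hY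
    have : z Y ≠ 0 := by simp [hz, hY.ne']
    field_simp
    ring
  have hne : ∀ᶠ Y in atTop, g (z Y) ≠ 0 := by
    filter_upwards [hratio.eventually_ne one_ne_zero] with Y hY h0
    exact hY (by rw [h0, zero_div])
  have hgc : Tendsto (fun Y => g (z Y)) atTop (cobounded ℂ) := by
    rw [← tendsto_norm_atTop_iff_cobounded]
    have h3 : Tendsto (fun Y => ‖g (z Y) / z Y‖ * ‖z Y‖) atTop atTop :=
      hratio.norm.pos_mul_atTop (by simp) (tendsto_norm_atTop_iff_cobounded.2 hzc)
    refine h3.congr' ?_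
    filter_upwards [eventually_gt_atTop 0] with Y hY
    have : z Y ≠ 0 := by simp [hz, hY.ne']
    rw [← norm_mul, div_mul_cancel₀ _ this]
  have hgS : Tendsto (fun Y => g (z Y)) atTop (cobounded ℂ ⊓ 𝓟 (Sector (Real.pi / 4))) := by
    refine tendsto_inf.2 ⟨hgc, tendsto_principal.2 ?_⟩
    have h3 : Tendsto (fun Y => Complex.arg (g (z Y) / z Y * I)) atTop (𝓝 (Real.pi / 2)) := by
      have := (Complex.continuousAt_arg (x := I) (by simp [Complex.slitPlane])).tendsto
      rw [Complex.arg_I] at this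
      exact this.comp (by simpa using hratio.mul_const I)
    filter_upwards [h3.eventually (Ioo_mem_nhds hπ4' (show _ < Real.pi - Real.pi / 4 by linarith)),
      eventually_gt_atTop 0] with Y hY hY0
    have h4 : g (z Y) = (Y : ℂ) * (g (z Y) / z Y * I) := by
      have : (Y : ℂ) ≠ 0 := by exact_mod_cast hY0.ne'
      simp only [hz]
      field_simp
    have h5 : Complex.arg (g (z Y)) = Complex.arg (g (z Y) / z Y * I) := by
      conv_lhs => rw [h4]
      exact Complex.arg_real_mul _ hY0
    exact ⟨by rw [h5]; exact hY.1, by rw [h5]; exact hY.2⟩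
  have l1 := (hg _ hπ4 hπ4').comp hzS
  have l2 := (hf _ hπ4 hπ4').comp hgS
  have l3 := (hk _ hπ4 hπ4').comp hzS
  have l4 := l1.add (l2.div hratio one_ne_zero)
  rw [div_one] at l4
  have heq : (fun z => z * (k z - z)) ∘ z =ᶠ[atTop] fun Y =>
      ((fun z => z * (g z - z)) ∘ z) Y +
        ((fun z => z * (f z - z)) ∘ fun Y => g (z Y)) Y / (g (z Y) / z Y) := by
    filter_upwards [hzD, hne, eventually_gt_atTop 0] with Y hY hY' hY0
    have : z Y ≠ 0 := by simp [hz, hY0.ne']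
    simp only [Function.comp_apply, hkfg _ (hηD hY)]
    field_simp
    ring
  have := tendsto_nhds_unique (l3.congr' heq) l4
  linear_combination -this

end Residue

/-- In an evolution family, `φ t s` satisfies (H.2) with angular
residue `λ(t) - λ(s)`; moreover `λ` is real-valued and non-decreasing on `I`. -/
theorem statement0 {T : ℝ} (hT : 0 < T) {I : Set ℝ}
    (hI : I = Set.Ico 0 T ∨ I = Set.Icc 0 T)
    {D : ℝ → Set ℂ} {φ : ℝ → ℝ → ℂ → ℂ} {lam : ℝ → ℂ}
    (hEF : IsEvolutionFamily I D φ lam) :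
    (∀ s ∈ I, ∀ t ∈ I, s ≤ t → SatisfiesH2 (φ t s) (lam t - lam s)) ∧
    (∀ t ∈ I, ∃ r : ℝ, lam t = (r : ℂ)) ∧
    (∀ s ∈ I, ∀ t ∈ I, s ≤ t → (lam s).re ≤ (lam t).re) := by
  have h0 : (0 : ℝ) ∈ I := by
    rcases hI with rfl | rfl
    · exact left_mem_Ico.2 hT
    · exact left_mem_Icc.2 hT.le
  have hnonneg : ∀ t ∈ I, 0 ≤ t := by
    rcases hI with rfl | rfl <;> exact fun t ht => ht.1
  have hres : ∀ s ∈ I, ∀ t ∈ I, s ≤ t → ∀ c, SatisfiesH2 (φ t s) c → c.im = 0 ∧ 0 ≤ c.re :=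
    fun s hs t ht hst c hc => hc.im_eq_zero_and_re_nonneg_of_isHHull (hEF.slit s hs)
      (hEF.slit t ht) (hEF.mapsTo s hs t ht hst) (hEF.holo s hs t ht hst)
      (hEF.inj s hs t ht hst) (hEF.h1 s hs t ht hst) (hEF.h3 s hs t ht hst)
  have hH2 : ∀ s ∈ I, ∀ t ∈ I, s ≤ t → SatisfiesH2 (φ t s) (lam t - lam s) := by
    intro s hs t ht hst
    obtain ⟨c, hc⟩ := hEF.h2 s hs t ht hst
    have := SatisfiesH2.residue_comp (hEF.h1 0 h0 s hs (hnonneg s hs)) (hEF.lam_res s hs) hc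
      (hEF.lam_res t ht) (hEF.ef2 0 h0 s hs t ht (hnonneg s hs) hst)
    rwa [this, add_sub_cancel_left]
  refine ⟨hH2, fun t ht => ⟨(lam t).re, ?_⟩, fun s hs t ht hst => ?_⟩
  · exact Complex.ext rfl (hres 0 h0 t ht (hnonneg t ht) _ (hEF.lam_res t ht)).1
  · have := (hres s hs t ht hst _ (hH2 s hs t ht hst)).2
    rw [Complex.sub_re] at this
    linarith
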